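/- arXiv:1911.01946 — 3 statements merged into one kernel-verified Lean document; each statement's English description precedes it below -/
import Mathlib

section
/- Blow-up at and below the critical exponent, integer case: Let n ≥ 1, let σ ≥ 1 be an integer, and let p, q > 1 satisfy n/(2σ) ≤ (1 + max{p,q})/(pq − 1). If u₁, v₁ ∈ L¹(ℝⁿ) satisfy ∫_{ℝⁿ} u₁(x) dx > 0 and ∫_{ℝⁿ} v₁(x) dx > 0, then there exists no global weak solution of the weakly coupled system with zero initial positions and initial velocities u₁, v₁. -/
open MeasureTheory Real Set
noncomputable section

abbrev Ω (n : ℕ) := EuclideanSpace ℝ (Fin n)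

/-- The Japanese bracket `⟨x⟩ = (1 + |x|²)^{1/2}`. -/
def jb {n : ℕ} (x : Ω n) : ℝ := Real.sqrt (1 + ‖x‖ ^ 2)

/-- The (negative of the) classical Laplacian: `(-Δ)f = -∑ᵢ ∂²f/∂xᵢ²`. -/
def negLap {n : ℕ} (f : Ω n → ℝ) : Ω n → ℝ := fun x =>
  -∑ i : Fin n, fderiv ℝ (fun y => fderiv ℝ f y (EuclideanSpace.single i 1)) x
    (EuclideanSpace.single i 1)

/-- The `m`-fold iterate `(-Δ)^m`. -/
def negLapIter {n : ℕ} (m : ℕ) (f : Ω n → ℝ) : Ω n → ℝ := negLap^[m] f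

/-- The normalizing constant `C(n,s) = 4^s Γ(n/2+s) / (π^{n/2} |Γ(-s)|)` of the
fractional Laplacian. -/
def fracC (n : ℕ) (s : ℝ) : ℝ :=
  4 ^ s * Real.Gamma ((n : ℝ) / 2 + s) / (Real.pi ^ ((n : ℝ) / 2) * |Real.Gamma (-s)|)

/-- The singular integrand defining `(-Δ)^s f (x)`. -/
def fracIntegrand {n : ℕ} (s : ℝ) (f : Ω n → ℝ) (x y : Ω n) : ℝ :=
  (2 * f x - f (x + y) - f (x - y)) / ‖y‖ ^ ((n : ℝ) + 2 * s)

/-- The fractional Laplacian `(-Δ)^s`, `s ∈ (0,1)`, via the singular integral. -/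
def fracLapS {n : ℕ} (s : ℝ) (f : Ω n → ℝ) (x : Ω n) : ℝ :=
  (fracC n s / 2) * ∫ y : Ω n, fracIntegrand s f x y

/-- The fractional Laplacian `(-Δ)^γ := (-Δ)^{γ - [γ]} ∘ (-Δ)^{[γ]}` for non-integer `γ > 1`. -/
def fracLap {n : ℕ} (γ : ℝ) (f : Ω n → ℝ) : Ω n → ℝ :=
  fracLapS (γ - ⌊γ⌋₊) (negLapIter ⌊γ⌋₊ f)

end

noncomputable section
open Function

variable {n : ℕ}

abbrev L2r (n : ℕ) := Lp ℝ 2 (volume : Measure (Ω n))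

/-- Time derivative of a space–time test function. -/
def Dt (φ : ℝ → Ω n → ℝ) : ℝ → Ω n → ℝ := fun t x => deriv (fun s => φ s x) t

/-- The dual operator `∂_t² − ∂_t + (−Δ)^σ` (integer `σ`) applied to a test function. -/
def testOpInt (σ : ℕ) (φ : ℝ → Ω n → ℝ) : ℝ → Ω n → ℝ :=
  fun t x => Dt (Dt φ) t x - Dt φ t x + negLapIter σ (φ t) x

/-- A global weak solution of
`u_tt + (−Δ)^σ u + u_t = |v|^p`, `v_tt + (−Δ)^σ v + v_t = |u|^q`
(integer `σ`) with zero initial positions and initial velocities `u₁, v₁`. -/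
def IsWeakSolutionInt (n : ℕ) (σ : ℕ) (p q : ℝ) (u₁ v₁ : Ω n → ℝ)
    (u v : ℝ → L2r n) : Prop :=
  ContinuousOn u (Set.Ici 0) ∧ ContinuousOn v (Set.Ici 0) ∧
  ∀ φ : ℝ → Ω n → ℝ, ContDiff ℝ (⊤ : ℕ∞) (uncurry φ) → HasCompactSupport (uncurry φ) →
    (∀ t ∈ Set.Ici (0 : ℝ),
      Integrable (fun x => (u t : Ω n → ℝ) x * testOpInt σ φ t x) volume ∧
      Integrable (fun x => (v t : Ω n → ℝ) x * testOpInt σ φ t x) volume ∧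
      Integrable (fun x => |(v t : Ω n → ℝ) x| ^ p * φ t x) volume ∧
      Integrable (fun x => |(u t : Ω n → ℝ) x| ^ q * φ t x) volume) ∧
    IntegrableOn (fun t => ∫ x, (u t : Ω n → ℝ) x * testOpInt σ φ t x) (Set.Ici 0) ∧
    IntegrableOn (fun t => ∫ x, (v t : Ω n → ℝ) x * testOpInt σ φ t x) (Set.Ici 0) ∧
    IntegrableOn (fun t => ∫ x, |(v t : Ω n → ℝ) x| ^ p * φ t x) (Set.Ici 0) ∧
    IntegrableOn (fun t => ∫ x, |(u t : Ω n → ℝ) x| ^ q * φ t x) (Set.Ici 0) ∧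
    (∫ t in Set.Ici (0 : ℝ), ∫ x, (u t : Ω n → ℝ) x * testOpInt σ φ t x) =
      (∫ x, u₁ x * φ 0 x) + ∫ t in Set.Ici (0 : ℝ), ∫ x, |(v t : Ω n → ℝ) x| ^ p * φ t x ∧
    (∫ t in Set.Ici (0 : ℝ), ∫ x, (v t : Ω n → ℝ) x * testOpInt σ φ t x) =
      (∫ x, v₁ x * φ 0 x) + ∫ t in Set.Ici (0 : ℝ), ∫ x, |(u t : Ω n → ℝ) x| ^ q * φ t x

/-- `F` is the product of `ψ ^ m` and a smooth function. -/
def SmoothMultiple {E : Type*} [NormedAddCommGroup E] [NormedSpace ℝ E]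
    (ψ : E → ℝ) (m : ℕ) (F : E → ℝ) : Prop :=
  ∃ g : E → ℝ, ContDiff ℝ (⊤ : ℕ∞) g ∧ F = fun z => ψ z ^ m * g z

namespace SmoothMultiple

variable {E : Type*} [NormedAddCommGroup E] [NormedSpace ℝ E] {ψ F : E → ℝ} {m : ℕ}

lemma contDiff (h : SmoothMultiple ψ m F) (hψ : ContDiff ℝ (⊤ : ℕ∞) ψ) :
    ContDiff ℝ (⊤ : ℕ∞) F := by
  obtain ⟨g, hg, rfl⟩ := h
  exact (hψ.pow m).mul hg

lemma of_le {k : ℕ} (h : SmoothMultiple ψ k F) (hψ : ContDiff ℝ (⊤ : ℕ∞) ψ) (hmk : m ≤ k) :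
    SmoothMultiple ψ m F := by
  obtain ⟨g, hg, rfl⟩ := h
  refine ⟨fun z => ψ z ^ (k - m) * g z, (hψ.pow _).mul hg, ?_⟩
  funext z
  rw [← mul_assoc, ← pow_add, Nat.add_sub_cancel' hmk]

lemma neg (h : SmoothMultiple ψ m F) : SmoothMultiple ψ m (fun z => -F z) := by
  obtain ⟨g, hg, rfl⟩ := h
  exact ⟨fun z => -g z, hg.neg, by funext z; ring⟩

lemma sum {ι : Type*} (s : Finset ι) {F : ι → E → ℝ} (h : ∀ i, SmoothMultiple ψ m (F i)) :
    SmoothMultiple ψ m (fun z => ∑ i ∈ s, F i z) := by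
  choose g hg hF using h
  refine ⟨fun z => ∑ i ∈ s, g i z, ContDiff.sum fun i _ => hg i, ?_⟩
  funext z
  rw [Finset.mul_sum]
  exact Finset.sum_congr rfl fun i _ => congrFun (hF i) z

lemma fderiv_apply (h : SmoothMultiple ψ (m + 1) F) (hψ : ContDiff ℝ (⊤ : ℕ∞) ψ) (w : E) :
    SmoothMultiple ψ m (fun z => fderiv ℝ F z w) := by
  obtain ⟨g, hg, rfl⟩ := h
  have hdir : ∀ {f : E → ℝ}, ContDiff ℝ (⊤ : ℕ∞) f →
      ContDiff ℝ (⊤ : ℕ∞) (fun z => fderiv ℝ f z w) := fun hf =>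
    (hf.fderiv_right (m := (⊤ : ℕ∞)) (by simp)).clm_apply contDiff_const
  refine ⟨fun z => (m + 1) * g z * fderiv ℝ ψ z w + ψ z * fderiv ℝ g z w,
    ((contDiff_const.mul hg).mul (hdir hψ)).add (hψ.mul (hdir hg)), ?_⟩
  funext z
  have h1 : HasFDerivAt ψ (fderiv ℝ ψ z) z := (hψ.differentiable (by simp) z).hasFDerivAt
  have h2 : HasFDerivAt g (fderiv ℝ g z) z := (hg.differentiable (by simp) z).hasFDerivAt
  have h3 : HasFDerivAt (fun z => ψ z ^ (m + 1) * g z) _ z := (h1.pow (m + 1)).mul h2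
  rw [h3.fderiv]
  simp
  ring

lemma exists_abs_le (h : SmoothMultiple ψ m F) (hm : m ≠ 0) (hψ : HasCompactSupport ψ)
    (hψ0 : ∀ z, 0 ≤ ψ z) : ∃ C, 0 ≤ C ∧ ∀ z, |F z| ≤ C * ψ z ^ m := by
  obtain ⟨g, hg, rfl⟩ := h
  obtain ⟨C, hC⟩ := hψ.isCompact.exists_bound_of_continuousOn hg.continuous.continuousOn
  refine ⟨max C 0, le_max_right _ _, fun z => ?_⟩
  have hz := pow_nonneg (hψ0 z) m
  rw [abs_mul, abs_of_nonneg hz, mul_comm]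
  by_cases hmem : z ∈ tsupport ψ
  · exact mul_le_mul_of_nonneg_right ((hC z hmem).trans (le_max_left _ _)) hz
  · simp [image_eq_zero_of_notMem_tsupport hmem, hm]

end SmoothMultiple

lemma Dt_eq_fderiv {φ : ℝ → Ω n → ℝ} (hφ : ContDiff ℝ (⊤ : ℕ∞) (uncurry φ)) (t : ℝ) (x : Ω n) :
    Dt φ t x = fderiv ℝ (uncurry φ) (t, x) (1, 0) := by
  have h : HasFDerivAt (uncurry φ) (fderiv ℝ (uncurry φ) (t, x)) (t, x) :=
    (hφ.differentiable (by simp) _).hasFDerivAt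
  exact (h.comp_hasDerivAt t ((hasDerivAt_id t).prodMk (hasDerivAt_const t x))).deriv

lemma fderiv_slice {φ : ℝ → Ω n → ℝ} (hφ : ContDiff ℝ (⊤ : ℕ∞) (uncurry φ)) (t : ℝ)
    (x e : Ω n) : fderiv ℝ (φ t) x e = fderiv ℝ (uncurry φ) (t, x) (0, e) := by
  have h : HasFDerivAt (uncurry φ) (fderiv ℝ (uncurry φ) (t, x)) (t, x) :=
    (hφ.differentiable (by simp) _).hasFDerivAt
  have h' : HasFDerivAt (φ t) _ x := h.comp x (hasFDerivAt_prodMk_right t x)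
  rw [h'.fderiv]
  simp

lemma SmoothMultiple.Dt {ψ : ℝ × Ω n → ℝ} {m : ℕ} {φ : ℝ → Ω n → ℝ}
    (hψ : ContDiff ℝ (⊤ : ℕ∞) ψ) (h : SmoothMultiple ψ (m + 1) (uncurry φ)) :
    SmoothMultiple ψ m (uncurry (Dt φ)) := by
  have key : uncurry (_root_.Dt φ) = fun z => fderiv ℝ (uncurry φ) z (1, 0) := by
    funext ⟨t, x⟩
    exact Dt_eq_fderiv (h.contDiff hψ) t x
  rw [key]
  exact h.fderiv_apply hψ _

lemma SmoothMultiple.negLap {ψ : ℝ × Ω n → ℝ} {m : ℕ} {φ : ℝ → Ω n → ℝ}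
    (hψ : ContDiff ℝ (⊤ : ℕ∞) ψ) (h : SmoothMultiple ψ (m + 2) (uncurry φ)) :
    SmoothMultiple ψ m (uncurry fun t => negLap (φ t)) := by
  have hG : ∀ e : Ω n, SmoothMultiple ψ (m + 1)
      (uncurry fun t x => fderiv ℝ (uncurry φ) (t, x) (0, e)) := fun e =>
    SmoothMultiple.fderiv_apply (m := m + 1) h hψ (0, e)
  have key : uncurry (fun t => _root_.negLap (φ t)) = fun z => -∑ i : Fin n,
      fderiv ℝ (uncurry fun t x => fderiv ℝ (uncurry φ) (t, x)
        (0, EuclideanSpace.single i 1)) z (0, EuclideanSpace.single i 1) := by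
    funext ⟨t, x⟩
    simp only [uncurry_apply_pair, _root_.negLap, fderiv_slice (h.contDiff hψ)]
    congr 1
    refine Finset.sum_congr rfl fun i _ => ?_
    exact fderiv_slice ((hG (EuclideanSpace.single i 1)).contDiff hψ) t x _
  rw [key]
  exact (SmoothMultiple.sum _ fun i => (hG _).fderiv_apply hψ _).neg

lemma SmoothMultiple.negLapIter {ψ : ℝ × Ω n → ℝ} (hψ : ContDiff ℝ (⊤ : ℕ∞) ψ) (σ : ℕ) {m : ℕ}
    {φ : ℝ → Ω n → ℝ} (h : SmoothMultiple ψ (m + 2 * σ) (uncurry φ)) :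
    SmoothMultiple ψ m (uncurry fun t => negLapIter σ (φ t)) := by
  induction σ generalizing φ with
  | zero => simpa [_root_.negLapIter] using h
  | succ k ih =>
    have := ih (φ := fun t => _root_.negLap (φ t))
      (SmoothMultiple.negLap hψ (by rwa [mul_add, mul_one, ← add_assoc] at h))
    simpa [_root_.negLapIter] using this

/-- The anisotropic rescaling `(t, x) ↦ Ψ (a ^ (2σ) t, a x)`. -/
def rescale (σ : ℕ) (a : ℝ) (Ψ : ℝ → Ω n → ℝ) : ℝ → Ω n → ℝ :=
  fun t x => Ψ (a ^ (2 * σ) * t) (a • x)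

lemma Dt_const_mul_rescale (σ : ℕ) (a c : ℝ) (Ψ : ℝ → Ω n → ℝ) :
    Dt (fun t x => c * rescale σ a Ψ t x) =
      fun t x => (c * a ^ (2 * σ)) * rescale σ a (Dt Ψ) t x := by
  funext t x
  simp only [Dt, rescale, deriv_const_mul_field]
  rw [deriv_comp_mul_left (a ^ (2 * σ)) (fun s => Ψ s (a • x)) t, smul_eq_mul, mul_assoc]

lemma negLap_const_mul_comp_smul {a : ℝ} (c : ℝ) (f : Ω n → ℝ) :
    negLap (fun x => c * f (a • x)) = fun x => (c * a ^ 2) * negLap f (a • x) := by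
  have hd : ∀ (c : ℝ) (f : Ω n → ℝ) (x e : Ω n),
      fderiv ℝ (fun y => c * f (a • y)) x e = (c * a) * fderiv ℝ f (a • x) e := by
    intro c f x e
    have h1 : fderiv ℝ (fun y => c • f (a • y)) x = c • fderiv ℝ (fun y => f (a • y)) x :=
      congrFun (fderiv_const_smul_field c) x
    simp only [smul_eq_mul] at h1
    rw [h1, fderiv_comp_smul]
    simp [mul_assoc]
  funext x
  simp only [negLap, hd]
  rw [mul_neg, Finset.mul_sum]
  congr 1
  refine Finset.sum_congr rfl fun i _ => ?_
  rw [hd (c * a) fun y => fderiv ℝ f y (EuclideanSpace.single i 1)]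
  ring

lemma negLapIter_const_mul_comp_smul {a : ℝ} (σ : ℕ) (c : ℝ) (f : Ω n → ℝ) :
    negLapIter σ (fun x => c * f (a • x)) =
      fun x => (c * a ^ (2 * σ)) * negLapIter σ f (a • x) := by
  induction σ generalizing c f with
  | zero => simp [negLapIter]
  | succ k ih =>
    have := ih (c * a ^ 2) (negLap f)
    simp only [negLapIter, iterate_succ, comp_apply, negLap_const_mul_comp_smul] at this ⊢
    rw [this]
    funext x
    ring

lemma testOpInt_rescale (σ : ℕ) (a : ℝ) (Ψ : ℝ → Ω n → ℝ) (t : ℝ) (x : Ω n) :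
    testOpInt σ (rescale σ a Ψ) t x = a ^ (2 * σ) * (a ^ (2 * σ) * rescale σ a (Dt (Dt Ψ)) t x
      - rescale σ a (Dt Ψ) t x + rescale σ a (fun t => negLapIter σ (Ψ t)) t x) := by
  have h1 := Dt_const_mul_rescale σ a 1 Ψ
  simp only [one_mul] at h1
  have h2 := negLapIter_const_mul_comp_smul (a := a) σ 1 (Ψ (a ^ (2 * σ) * t))
  simp only [one_mul] at h2
  have h3 : negLapIter σ (rescale σ a Ψ t) = _ := h2
  rw [testOpInt, show Dt (rescale σ a Ψ) = _ from h1, Dt_const_mul_rescale, h3]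
  simp only [rescale]
  ring

lemma testOpInt_eq_zero_of_eventuallyEq_one {σ : ℕ} (hσ : 1 ≤ σ) {φ : ℝ → Ω n → ℝ} {U : Set ℝ}
    {V : Set (Ω n)} (hU : IsOpen U) (hV : IsOpen V) (h : ∀ t ∈ U, ∀ x ∈ V, φ t x = 1)
    {t : ℝ} {x : Ω n} (ht : t ∈ U) (hx : x ∈ V) : testOpInt σ φ t x = 0 := by
  have hD : ∀ s ∈ U, Dt φ s x = 0 := fun s hs => by
    have : (fun r => φ r x) =ᶠ[nhds s] fun _ => (1 : ℝ) :=
      Filter.eventually_of_mem (hU.mem_nhds hs) fun r hr => h r hr x hx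
    simp [Dt, this.deriv_eq]
  have hDD : Dt (Dt φ) t x = 0 := by
    have : (fun r => Dt φ r x) =ᶠ[nhds t] fun _ => (0 : ℝ) :=
      Filter.eventually_of_mem (hU.mem_nhds ht) hD
    rw [Dt, this.deriv_eq, deriv_const]
  have hL : ∀ (f : Ω n → ℝ) (c : ℝ), (∀ y ∈ V, f y = c) → ∀ y ∈ V, negLap f y = 0 := by
    have hf : ∀ (f : Ω n → ℝ) (c : ℝ), (∀ y ∈ V, f y = c) → ∀ y ∈ V, fderiv ℝ f y = 0 := by
      intro f c hc y hy
      have : f =ᶠ[nhds y] fun _ => c := Filter.eventually_of_mem (hV.mem_nhds hy) hc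
      rw [this.fderiv_eq, fderiv_fun_const, Pi.zero_apply]
    intro f c hc y hy
    simp only [negLap]
    refine neg_eq_zero.2 (Finset.sum_eq_zero fun i _ => ?_)
    rw [hf _ 0 (fun z hz => by simp [hf f c hc z hz]) y hy]
    simp
  have hI : ∀ k, ∀ y ∈ V, negLapIter (k + 1) (φ t) y = 0 := by
    intro k
    induction k with
    | zero => exact hL _ 1 (h t ht)
    | succ k ih =>
      intro y hy
      rw [negLapIter, iterate_succ_apply']
      exact hL _ 0 ih y hy
  obtain ⟨k, rfl⟩ := Nat.exists_eq_add_of_le' hσ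
  simp [testOpInt, hDD, hD t ht, hI k x hx]

/-- A smooth bump on space-time, equal to `1` on the unit ball and supported in the ball of
radius `2` (for the product norm). -/
def spaceTimeBump (n : ℕ) : ContDiffBump (0 : ℝ × Ω n) := ⟨1, 2, one_pos, one_lt_two⟩

/-- The test functions: powers of the bump, rescaled by `2 ^ k` in space and `2 ^ (2σk)` in
time. -/
def cutoff (n σ m k : ℕ) : ℝ → Ω n → ℝ :=
  rescale σ ((2 : ℝ) ^ k)⁻¹ fun t x => spaceTimeBump n (t, x) ^ (m + 2 * σ)

section cutoff

variable {σ m k : ℕ} {t : ℝ} {x : Ω n}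

lemma rescale_arg_mem {r : ℝ} :
    ‖(((((2 : ℝ) ^ k)⁻¹) ^ (2 * σ) * t, ((2 : ℝ) ^ k)⁻¹ • x) : ℝ × Ω n)‖ < r ↔
      |t| < r * (2 ^ k) ^ (2 * σ) ∧ ‖x‖ < r * 2 ^ k := by
  have h1 : (0 : ℝ) < 2 ^ k := by positivity
  have h2 : (0 : ℝ) < (2 ^ k) ^ (2 * σ) := by positivity
  rw [Prod.norm_def, max_lt_iff, norm_smul, Real.norm_eq_abs, abs_mul, inv_pow, norm_inv,
    Real.norm_of_nonneg h1.le, abs_of_pos (inv_pos.2 h2), inv_mul_lt_iff₀ h2, inv_mul_lt_iff₀ h1,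
    mul_comm r, mul_comm r]

lemma contDiff_cutoff : ContDiff ℝ (⊤ : ℕ∞) (uncurry (cutoff n σ m k)) := by
  have h : ContDiff ℝ (⊤ : ℕ∞) fun z : ℝ × Ω n =>
      (((((2 : ℝ) ^ k)⁻¹) ^ (2 * σ) * z.1, ((2 : ℝ) ^ k)⁻¹ • z.2) : ℝ × Ω n) := by fun_prop
  exact (((spaceTimeBump n).contDiff (n := (⊤ : ℕ∞))).comp h).pow _

lemma cutoff_nonneg : 0 ≤ cutoff n σ m k t x := pow_nonneg (spaceTimeBump n).nonneg _

lemma cutoff_le_one : cutoff n σ m k t x ≤ 1 :=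
  pow_le_one₀ (spaceTimeBump n).nonneg (spaceTimeBump n).le_one

lemma cutoff_eq_one (ht : |t| < (2 ^ k) ^ (2 * σ)) (hx : ‖x‖ < 2 ^ k) :
    cutoff n σ m k t x = 1 := by
  have := (rescale_arg_mem (r := 1)).2 ⟨by simpa using ht, by simpa using hx⟩
  simp only [cutoff, rescale]
  rw [(spaceTimeBump n).one_of_mem_closedBall, one_pow]
  simpa [spaceTimeBump] using this.le

lemma abs_lt_and_norm_lt_of_bump_ne_zero
    (h : rescale σ ((2 : ℝ) ^ k)⁻¹ (fun t x => spaceTimeBump n (t, x)) t x ≠ 0) :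
    |t| < 2 * (2 ^ k) ^ (2 * σ) ∧ ‖x‖ < 2 * 2 ^ k := by
  refine rescale_arg_mem.1 ?_
  by_contra hlt
  refine h ((spaceTimeBump n).zero_of_le_dist ?_)
  simpa [spaceTimeBump] using not_lt.1 hlt

lemma abs_lt_and_norm_lt_of_cutoff_ne_zero (hσ : 1 ≤ σ) (h : cutoff n σ m k t x ≠ 0) :
    |t| < 2 * (2 ^ k) ^ (2 * σ) ∧ ‖x‖ < 2 * 2 ^ k :=
  abs_lt_and_norm_lt_of_bump_ne_zero fun h0 => h ((pow_eq_zero_iff (by omega)).2 h0)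

lemma hasCompactSupport_cutoff (hσ : 1 ≤ σ) : HasCompactSupport (uncurry (cutoff n σ m k)) := by
  refine HasCompactSupport.intro ((isCompact_closedBall (0 : ℝ) (2 * (2 ^ k) ^ (2 * σ))).prod
    (isCompact_closedBall (0 : Ω n) (2 * 2 ^ k))) fun z hz => ?_
  by_contra h
  obtain ⟨h1, h2⟩ := abs_lt_and_norm_lt_of_cutoff_ne_zero hσ (t := z.1) (x := z.2) h
  exact hz ⟨by simpa using h1.le, by simpa using h2.le⟩

lemma lt_succ_scale (hσ : 1 ≤ σ) (h : |t| < 2 * (2 ^ k) ^ (2 * σ) ∧ ‖x‖ < 2 * 2 ^ k) :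
    |t| < (2 ^ (k + 1)) ^ (2 * σ) ∧ ‖x‖ < 2 ^ (k + 1) := by
  refine ⟨h.1.trans_le ?_, h.2.trans_eq (by ring)⟩
  rw [pow_succ' (2 : ℝ) k, mul_pow]
  gcongr
  exact le_self_pow₀ one_le_two (by omega)

lemma cutoff_succ_eq_one (hσ : 1 ≤ σ) (h : cutoff n σ m k t x ≠ 0) :
    cutoff n σ m (k + 1) t x = 1 := by
  obtain ⟨h1, h2⟩ := lt_succ_scale hσ (abs_lt_and_norm_lt_of_cutoff_ne_zero hσ h)
  exact cutoff_eq_one h1 h2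

lemma cutoff_le_cutoff_succ (hσ : 1 ≤ σ) : cutoff n σ m k t x ≤ cutoff n σ m (k + 1) t x := by
  by_cases h : cutoff n σ m k t x = 0
  · rw [h]
    exact cutoff_nonneg
  · rw [cutoff_succ_eq_one hσ h]
    exact cutoff_le_one

lemma testOpInt_cutoff_succ_eq_zero (hσ : 1 ≤ σ) (h : cutoff n σ m k t x ≠ 0) :
    testOpInt σ (cutoff n σ m (k + 1)) t x = 0 := by
  obtain ⟨h1, h2⟩ := lt_succ_scale hσ (abs_lt_and_norm_lt_of_cutoff_ne_zero hσ h)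
  refine testOpInt_eq_zero_of_eventuallyEq_one hσ
    (U := {t | |t| < (2 ^ (k + 1)) ^ (2 * σ)}) (V := {x | ‖x‖ < 2 ^ (k + 1)})
    (isOpen_lt continuous_abs continuous_const) (isOpen_lt continuous_norm continuous_const)
    (fun t ht x hx => cutoff_eq_one ht hx) h1 h2

lemma exists_abs_testOpInt_cutoff_le (n : ℕ) (hσ : 1 ≤ σ) (hm : m ≠ 0) :
    ∃ C : ℝ, 0 ≤ C ∧ ∀ k t (x : Ω n), |testOpInt σ (cutoff n σ m k) t x| ≤
      C * (((2 : ℝ) ^ k)⁻¹) ^ (2 * σ) *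
        rescale σ ((2 : ℝ) ^ k)⁻¹ (fun t x => spaceTimeBump n (t, x)) t x ^ m := by
  set Ψ : ℝ → Ω n → ℝ := fun t x => spaceTimeBump n (t, x) ^ (m + 2 * σ)
  set ψ : ℝ × Ω n → ℝ := ⇑(spaceTimeBump n)
  have hψ : ContDiff ℝ (⊤ : ℕ∞) ψ := (spaceTimeBump n).contDiff
  have hΨ : SmoothMultiple ψ (m + 2 * σ) (uncurry Ψ) := 
    ⟨fun _ => 1, contDiff_const, by ext ⟨t, x⟩; simp [Ψ, ψ]⟩
  have hD : SmoothMultiple ψ (m + 1) (uncurry (Dt Ψ)) :=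
    SmoothMultiple.Dt hψ (hΨ.of_le hψ (by omega))
  have hDD : SmoothMultiple ψ m (uncurry (Dt (Dt Ψ))) := SmoothMultiple.Dt hψ hD
  have hL : SmoothMultiple ψ m (uncurry fun t => negLapIter σ (Ψ t)) :=
    SmoothMultiple.negLapIter hψ σ hΨ
  have hc : HasCompactSupport ψ := (spaceTimeBump n).hasCompactSupport
  have h0 : ∀ z, 0 ≤ ψ z := fun z => (spaceTimeBump n).nonneg
  obtain ⟨C₁, hC₁, h₁⟩ := (hD.of_le hψ (Nat.le_succ m)).exists_abs_le hm hc h0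
  obtain ⟨C₂, hC₂, h₂⟩ := hDD.exists_abs_le hm hc h0
  obtain ⟨C₃, hC₃, h₃⟩ := hL.exists_abs_le hm hc h0
  refine ⟨C₂ + C₁ + C₃, by positivity, fun k t x => ?_⟩
  set a : ℝ := ((2 : ℝ) ^ k)⁻¹
  have ha0 : 0 ≤ a ^ (2 * σ) := by positivity
  have ha1 : a ^ (2 * σ) ≤ 1 :=
    pow_le_one₀ (by positivity) (inv_le_one_of_one_le₀ (one_le_pow₀ one_le_two))
  rw [cutoff, testOpInt_rescale, abs_mul, abs_of_nonneg ha0, mul_comm _ (a ^ (2 * σ)), mul_assoc]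
  refine mul_le_mul_of_nonneg_left ?_ ha0
  have e₁ : |rescale σ a (Dt Ψ) t x| ≤ _ := h₁ (a ^ (2 * σ) * t, a • x)
  have e₂ : |rescale σ a (Dt (Dt Ψ)) t x| ≤ _ := h₂ (a ^ (2 * σ) * t, a • x)
  have e₃ : |rescale σ a (fun t => negLapIter σ (Ψ t)) t x| ≤ _ :=
    h₃ (a ^ (2 * σ) * t, a • x)
  calc _ ≤ |a ^ (2 * σ) * rescale σ a (Dt (Dt Ψ)) t x| + |rescale σ a (Dt Ψ) t x|
        + |rescale σ a (fun t => negLapIter σ (Ψ t)) t x| :=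
        (abs_add_le _ _).trans (by gcongr; exact abs_sub _ _)
    _ ≤ |rescale σ a (Dt (Dt Ψ)) t x| + |rescale σ a (Dt Ψ) t x|
        + |rescale σ a (fun t => negLapIter σ (Ψ t)) t x| := by
        rw [abs_mul, abs_of_nonneg ha0]
        gcongr
        exact mul_le_of_le_one_left (abs_nonneg _) ha1
    _ ≤ _ := by
        rw [add_mul, add_mul]
        exact add_le_add (add_le_add e₂ e₁) e₃

end cutoff

lemma mul_le_rpow_add_rpow {a b δ q : ℝ} (ha : 0 ≤ a) (hb : 0 ≤ b) (hδ : 0 < δ) (hq : 1 < q) :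
    a * b ≤ δ * a ^ q + δ ^ (-(1 / (q - 1))) * b ^ (q / (q - 1)) := by
  have hq1 : 0 < q - 1 := by linarith
  rcases le_total b (δ * a ^ (q - 1)) with h | h
  · have : a * b ≤ δ * a ^ q := by
      calc a * b ≤ a * (δ * a ^ (q - 1)) := by gcongr
        _ = δ * a ^ q := by
          rw [mul_left_comm, mul_comm a, ← Real.rpow_add_one' ha (by linarith)]
          ring_nf
    have : 0 ≤ δ ^ (-(1 / (q - 1))) * b ^ (q / (q - 1)) := by positivity
    linarith
  · have h1 : a ≤ (δ⁻¹ * b) ^ (1 / (q - 1)) := by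
      rw [one_div, Real.le_rpow_inv_iff_of_pos ha (by positivity) hq1]
      rwa [le_inv_mul_iff₀ hδ]
    have h2 : a * b ≤ δ ^ (-(1 / (q - 1))) * b ^ (q / (q - 1)) := by
      calc a * b ≤ (δ⁻¹ * b) ^ (1 / (q - 1)) * b := by gcongr
        _ = δ ^ (-(1 / (q - 1))) * b ^ (q / (q - 1)) := by
          rw [Real.mul_rpow (by positivity) hb, Real.inv_rpow hδ.le, ← Real.rpow_neg hδ.le,
            mul_assoc, ← Real.rpow_add_one' hb (by positivity)]
          congr 2
          field_simp
          ring
    have : 0 ≤ δ * a ^ q := by positivity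
    linarith

lemma exists_mul_testOpInt_cutoff_le (n : ℕ) {σ m : ℕ} {q : ℝ} (hσ : 1 ≤ σ) (hm : m ≠ 0)
    (hq : 1 < q) (hmq : (m + 2 * σ : ℕ) ≤ q * m) :
    ∃ C : ℝ, 0 ≤ C ∧ ∀ (k : ℕ) (y δ t : ℝ) (x : Ω n), 0 < δ → 0 ≤ t →
      y * testOpInt σ (cutoff n σ m (k + 1)) t x ≤
        δ * (|y| ^ q * cutoff n σ m (k + 1) t x - |y| ^ q * cutoff n σ m k t x) +
        δ ^ (-(1 / (q - 1))) * (C * (((2 : ℝ) ^ (k + 1))⁻¹) ^ (2 * σ)) ^ (q / (q - 1)) *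
        ((Icc 0 (2 * (2 ^ (k + 1)) ^ (2 * σ))).indicator 1 t *
          (Metric.closedBall 0 (2 * 2 ^ (k + 1))).indicator 1 x) := by
  obtain ⟨C, hC, h⟩ := exists_abs_testOpInt_cutoff_le n hσ hm
  refine ⟨C, hC, fun k y δ t x hδ ht => ?_⟩
  set a : ℝ := ((2 : ℝ) ^ (k + 1))⁻¹
  set b : ℝ := C * a ^ (2 * σ)
  set s : ℝ := rescale σ a (fun t x => spaceTimeBump n (t, x)) t x with hs
  have hs0 : 0 ≤ s := (spaceTimeBump n).nonneg
  have hs1 : s ≤ 1 := (spaceTimeBump n).le_one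
  have hb : 0 ≤ b := by positivity
  have hy : 0 ≤ |y| ^ q := by positivity
  have hind : (0 : ℝ) ≤ (Icc 0 (2 * (2 ^ (k + 1)) ^ (2 * σ))).indicator 1 t *
      (Metric.closedBall (0 : Ω n) (2 * 2 ^ (k + 1))).indicator 1 x :=
    mul_nonneg (indicator_nonneg (fun _ _ => zero_le_one) _)
      (indicator_nonneg (fun _ _ => zero_le_one) _)
  have hB : 0 ≤ δ ^ (-(1 / (q - 1))) * b ^ (q / (q - 1)) := by positivity
  have hw : 0 ≤ δ * (|y| ^ q * cutoff n σ m (k + 1) t x - |y| ^ q * cutoff n σ m k t x) :=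
    mul_nonneg hδ.le (sub_nonneg.2 (mul_le_mul_of_nonneg_left (cutoff_le_cutoff_succ hσ) hy))
  by_cases hT : testOpInt σ (cutoff n σ m (k + 1)) t x = 0
  · rw [hT, mul_zero]
    exact add_nonneg hw (mul_nonneg hB hind)
  · have hk : cutoff n σ m k t x = 0 := by
      by_contra hne
      exact hT (testOpInt_cutoff_succ_eq_zero hσ hne)
    have hsne : s ≠ 0 := by
      intro h0
      have := h (k + 1) t x
      rw [← hs, h0, zero_pow hm, mul_zero] at this
      exact hT (abs_nonpos_iff.1 this)
    obtain ⟨h1, h2⟩ := abs_lt_and_norm_lt_of_bump_ne_zero hsne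
    rw [abs_of_nonneg ht] at h1
    rw [hk, indicator_of_mem (by exact ⟨ht, h1.le⟩), indicator_of_mem (by simpa using h2.le)]
    have hsq : (s ^ m) ^ q ≤ cutoff n σ m (k + 1) t x := by
      have : cutoff n σ m (k + 1) t x = s ^ (m + 2 * σ) := rfl
      rw [this, ← Real.rpow_natCast, ← Real.rpow_natCast, ← Real.rpow_mul hs0, mul_comm (m : ℝ)]
      exact Real.rpow_le_rpow_of_exponent_ge (lt_of_le_of_ne hs0 hsne.symm) hs1 hmq
    calc y * testOpInt σ (cutoff n σ m (k + 1)) t x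
        ≤ |y| * |testOpInt σ (cutoff n σ m (k + 1)) t x| := by
          rw [← abs_mul]
          exact le_abs_self _
      _ ≤ |y| * (b * s ^ m) := by
          gcongr
          exact h (k + 1) t x
      _ = (|y| * s ^ m) * b := by ring
      _ ≤ δ * (|y| * s ^ m) ^ q + δ ^ (-(1 / (q - 1))) * b ^ (q / (q - 1)) :=
          mul_le_rpow_add_rpow (by positivity) hb hδ hq
      _ ≤ _ := by
          rw [Real.mul_rpow (abs_nonneg _) (by positivity)]
          simp only [Pi.one_apply, mul_one, mul_zero, sub_zero]
          gcongr

lemma exists_integral_mul_testOpInt_cutoff_le (n : ℕ) {σ m : ℕ} {q : ℝ} (hσ : 1 ≤ σ)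
    (hm : m ≠ 0) (hq : 1 < q) (hmq : (m + 2 * σ : ℕ) ≤ q * m) :
    ∃ K : ℝ, 0 ≤ K ∧ ∀ (u : ℝ → Ω n → ℝ),
      (∀ k, ∀ t ∈ Ici (0 : ℝ),
        Integrable (fun x => u t x * testOpInt σ (cutoff n σ m k) t x) ∧
        Integrable (fun x => |u t x| ^ q * cutoff n σ m k t x)) →
      (∀ k, IntegrableOn (fun t => ∫ x, u t x * testOpInt σ (cutoff n σ m k) t x) (Ici 0)) →
      (∀ k, IntegrableOn (fun t => ∫ x, |u t x| ^ q * cutoff n σ m k t x) (Ici 0)) →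
      ∀ (k : ℕ) (δ : ℝ), 0 < δ →
      ∫ t in Ici (0 : ℝ), ∫ x, u t x * testOpInt σ (cutoff n σ m (k + 1)) t x ≤
        δ * ((∫ t in Ici (0 : ℝ), ∫ x, |u t x| ^ q * cutoff n σ m (k + 1) t x) -
          ∫ t in Ici (0 : ℝ), ∫ x, |u t x| ^ q * cutoff n σ m k t x) +
        δ ^ (-(1 / (q - 1))) * (K * ((2 : ℝ) ^ (k + 1)) ^
          ((n : ℝ) + 2 * σ - 2 * σ * (q / (q - 1)))) := by
  obtain ⟨C, hC, h⟩ := exists_mul_testOpInt_cutoff_le n hσ hm hq hmq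
  set ω : ℝ := volume.real (Metric.ball (0 : Ω n) 1)
  refine ⟨C ^ (q / (q - 1)) * (2 * 2 ^ n * ω), by positivity, ?_⟩
  intro u hx hT hW k δ hδ
  set R : ℝ := 2 ^ (k + 1)
  have hR : 0 < R := by positivity
  set B : ℝ := δ ^ (-(1 / (q - 1))) * (C * (R⁻¹) ^ (2 * σ)) ^ (q / (q - 1))
  have hball : volume.real (Metric.closedBall (0 : Ω n) (2 * R)) = (2 * R) ^ n * ω := by
    rw [Measure.addHaar_real_closedBall _ _ (by positivity)]
    simp [ω]
  have hballfin : volume (Metric.closedBall (0 : Ω n) (2 * R)) ≠ ⊤ := measure_closedBall_lt_top.ne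
  have hgint : Integrable ((Metric.closedBall (0 : Ω n) (2 * R)).indicator (1 : Ω n → ℝ)) :=
    (integrable_indicator_iff Metric.isClosed_closedBall.measurableSet).2
      (integrableOn_const hballfin)
  have hfint : Integrable ((Icc 0 (2 * R ^ (2 * σ))).indicator (1 : ℝ → ℝ)) :=
    (integrable_indicator_iff measurableSet_Icc).2 (integrableOn_const measure_Icc_lt_top.ne)
  have inner : ∀ t ∈ Ici (0 : ℝ), ∫ x, u t x * testOpInt σ (cutoff n σ m (k + 1)) t x ≤
      δ * ((∫ x, |u t x| ^ q * cutoff n σ m (k + 1) t x) -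
        ∫ x, |u t x| ^ q * cutoff n σ m k t x) +
      B * ((Icc 0 (2 * R ^ (2 * σ))).indicator 1 t * ((2 * R) ^ n * ω)) := by
    intro t ht
    have i1 := ((hx (k + 1) t ht).2.sub (hx k t ht).2).const_mul δ
    have i2 := (hgint.const_mul ((Icc 0 (2 * R ^ (2 * σ))).indicator (1 : ℝ → ℝ) t)).const_mul B
    refine (integral_mono (hx (k + 1) t ht).1 (i1.add i2)
      fun x => h k (u t x) δ t x hδ ht).trans_eq ?_
    rw [integral_add' i1 i2, integral_const_mul, integral_const_mul, integral_const_mul,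
      integral_indicator_one Metric.isClosed_closedBall.measurableSet, hball]
    simp only [Pi.sub_apply]
    rw [integral_sub (hx (k + 1) t ht).2 (hx k t ht).2]
  have j1 := (((hW (k + 1)).sub (hW k)).const_mul δ)
  have j2 := ((hfint.mul_const ((2 * R) ^ n * ω)).const_mul B).restrict (s := Ici 0)
  refine (setIntegral_mono_on (hT (k + 1)) (j1.add j2) measurableSet_Ici inner).trans_eq ?_
  rw [integral_add' j1 j2, integral_const_mul, integral_const_mul, integral_mul_const,
    setIntegral_indicator measurableSet_Icc]
  simp only [Pi.sub_apply]
  rw [integral_sub (hW (k + 1)) (hW k)]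
  congr 1
  rw [inter_eq_self_of_subset_right Icc_subset_Ici_self]
  have hpow : ((R⁻¹) ^ (2 * σ)) ^ (q / (q - 1)) * (R ^ (2 * σ) * R ^ n) =
      R ^ ((n : ℝ) + 2 * σ - 2 * σ * (q / (q - 1))) := by
    rw [inv_pow, ← Real.rpow_natCast R, ← Real.rpow_natCast R, ← Real.rpow_neg hR.le,
      ← Real.rpow_mul hR.le, ← Real.rpow_add hR, ← Real.rpow_add hR]
    congr 1
    push_cast
    ring
  simp only [Pi.one_apply, integral_const, smul_eq_mul, mul_one, measureReal_restrict_apply_univ,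
    Real.volume_real_Icc_of_le (show (0 : ℝ) ≤ 2 * R ^ (2 * σ) by positivity), sub_zero, B]
  rw [← hpow, Real.mul_rpow hC (by positivity), mul_pow]
  ring

lemma tendsto_integral_mul_cutoff {σ m : ℕ} {f : Ω n → ℝ} (hf : Integrable f) :
    Filter.Tendsto (fun k => ∫ x, f x * cutoff n σ m k 0 x) Filter.atTop (nhds (∫ x, f x)) := by
  refine tendsto_integral_of_dominated_convergence (fun x => ‖f x‖) (fun k => ?_) hf.norm
    (fun k => ?_) ?_
  · refine hf.aestronglyMeasurable.mul (Continuous.aestronglyMeasurable ?_)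
    exact contDiff_cutoff.continuous.comp (by fun_prop : Continuous fun x : Ω n => ((0 : ℝ), x))
  · refine Filter.Eventually.of_forall fun x => ?_
    rw [norm_mul, Real.norm_of_nonneg cutoff_nonneg]
    exact mul_le_of_le_one_right (norm_nonneg _) cutoff_le_one
  · refine Filter.Eventually.of_forall fun x => ?_
    refine tendsto_const_nhds.congr' ?_
    filter_upwards [(tendsto_pow_atTop_atTop_of_one_lt one_lt_two).eventually_gt_atTop ‖x‖]
      with k hk
    rw [cutoff_eq_one (by simp) hk, mul_one]

/-- A monotone nonnegative sequence cannot be absorbed by its own increments up to arbitrarily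
small errors. -/
lemma false_of_absorption {I : ℕ → ℝ} {c K L s r : ℝ} {k₀ : ℕ} (hI : Monotone I)
    (hI0 : ∀ k, 0 ≤ I k) (hc : 0 < c) (hs : 0 < s) (hr : 0 < r)
    (h : ∀ δ ε : ℝ, 0 < δ → 0 < ε → ∀ k ≥ k₀,
      I (k + 1) + c ≤ δ * ε * (I (k + 1) - I k) + δ * ε ^ (-s) * L + δ ^ (-r) * K) : False := by
  have hbdd : BddAbove (range I) := by
    refine ⟨max (I k₀) (2 * (1 * (1 / 2) ^ (-s) * L + 1 ^ (-r) * K)), ?_⟩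
    rintro _ ⟨k, rfl⟩
    rcases le_or_gt k k₀ with hk | hk
    · exact (hI hk).trans (le_max_left _ _)
    · refine le_trans ?_ (le_max_right _ _)
      obtain ⟨j, rfl⟩ : ∃ j, k = j + 1 := ⟨k - 1, by omega⟩
      have := h 1 (1 / 2) one_pos (by norm_num) j (by omega)
      have := hI0 j
      linarith
  have hlim := tendsto_atTop_ciSup hI hbdd
  have hdiff : Filter.Tendsto (fun k => I (k + 1) - I k) Filter.atTop (nhds 0) := by
    simpa using ((Filter.tendsto_add_atTop_iff_nat 1).2 hlim).sub hlim
  have small : ∀ (r M : ℝ), 0 < r → ∃ δ : ℝ, 0 < δ ∧ δ ^ (-r) * M < c / 3 := by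
    intro r M hr
    have := (tendsto_rpow_neg_atTop hr).mul_const M
    rw [zero_mul] at this
    obtain ⟨δ, h1, h2⟩ := ((this.eventually_lt_const (show (0 : ℝ) < c / 3 by positivity)).and
      (Filter.eventually_gt_atTop 0)).exists
    exact ⟨δ, h2, h1⟩
  obtain ⟨δ, hδ, hδK⟩ := small r K hr
  obtain ⟨ε, hε, hεL⟩ := small s (δ * L) hs
  have hdiff' := hdiff.const_mul (δ * ε)
  rw [mul_zero] at hdiff'
  obtain ⟨k, hk, hk₀⟩ := ((hdiff'.eventually_lt_const (show (0 : ℝ) < c / 3 by positivity)).and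
    (Filter.eventually_ge_atTop k₀)).exists
  have h1 := h δ ε hδ hε k hk₀
  have h2 := hI0 (k + 1)
  have h3 : δ * ε ^ (-s) * L = ε ^ (-s) * (δ * L) := by ring
  linarith

lemma IsWeakSolutionInt.symm {σ : ℕ} {p q : ℝ} {u₁ v₁ : Ω n → ℝ} {u v : ℝ → L2r n}
    (h : IsWeakSolutionInt n σ p q u₁ v₁ u v) : IsWeakSolutionInt n σ q p v₁ u₁ v u := by
  refine ⟨h.2.1, h.1, fun φ h1 h2 => ?_⟩
  obtain ⟨a, b, c, d, e, f, g⟩ := h.2.2 φ h1 h2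
  exact ⟨fun t ht => ⟨(a t ht).2.1, (a t ht).1, (a t ht).2.2.2, (a t ht).2.2.1⟩,
    c, b, e, d, g, f⟩

lemma IsWeakSolutionInt.false_of_le {σ : ℕ} (hσ : 1 ≤ σ) {p q : ℝ} (hp : 1 < p) (hq : 1 < q)
    (hcrit : (n : ℝ) / (2 * σ) ≤ (1 + p) / (p * q - 1)) {u₁ v₁ : Ω n → ℝ}
    (hu₁ : Integrable u₁) (hv₁ : Integrable v₁) (hu : 0 < ∫ x, u₁ x) (hv : 0 < ∫ x, v₁ x)
    {u v : ℝ → L2r n} (h : IsWeakSolutionInt n σ p q u₁ v₁ u v) : False := by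
  have hp1 : 0 < p - 1 := by linarith
  have hq1 : 0 < q - 1 := by linarith
  have hσ0 : (0 : ℝ) < σ := by exact_mod_cast hσ
  obtain ⟨m, hm⟩ := exists_nat_gt (max (2 * σ / (p - 1)) (2 * σ / (q - 1)))
  obtain ⟨hmp, hmq⟩ := max_lt_iff.1 hm
  have hm0 : m ≠ 0 := by
    rintro rfl
    have : 0 < 2 * σ / (p - 1) := by positivity
    simp only [Nat.cast_zero] at hmp
    linarith
  rw [div_lt_iff₀ hp1] at hmp
  rw [div_lt_iff₀ hq1] at hmq
  obtain ⟨K, hK, hKu⟩ := exists_integral_mul_testOpInt_cutoff_le n hσ hm0 hq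
    (by push_cast; linarith)
  obtain ⟨L, hL, hLv⟩ := exists_integral_mul_testOpInt_cutoff_le n hσ hm0 hp
    (by push_cast; linarith)
  have H := fun k => h.2.2 (cutoff n σ m k) contDiff_cutoff (hasCompactSupport_cutoff hσ)
  replace hKu := hKu (fun t => u t) (fun k t ht => ⟨((H k).1 t ht).1, ((H k).1 t ht).2.2.2⟩)
    (fun k => (H k).2.1) (fun k => (H k).2.2.2.2.1)
  replace hLv := hLv (fun t => v t) (fun k t ht => ⟨((H k).1 t ht).2.1, ((H k).1 t ht).2.2.1⟩)
    (fun k => (H k).2.2.1) (fun k => (H k).2.2.2.1)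
  set I : ℕ → ℝ := fun k =>
    ∫ t in Ici (0 : ℝ), ∫ x, |(v t : Ω n → ℝ) x| ^ p * cutoff n σ m k t x with hIdef
  set J : ℕ → ℝ := fun k =>
    ∫ t in Ici (0 : ℝ), ∫ x, |(u t : Ω n → ℝ) x| ^ q * cutoff n σ m k t x with hJdef
  have hI0 : ∀ k, 0 ≤ I k := fun k => integral_nonneg fun t => integral_nonneg fun x =>
    mul_nonneg (by positivity) cutoff_nonneg
  have hJ0 : ∀ k, 0 ≤ J k := fun k => integral_nonneg fun t => integral_nonneg fun x =>
    mul_nonneg (by positivity) cutoff_nonneg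
  have hImono : Monotone I := by
    refine monotone_nat_of_le_succ fun k => ?_
    refine setIntegral_mono_on (H k).2.2.2.1 (H (k + 1)).2.2.2.1 measurableSet_Ici fun t ht => ?_
    exact integral_mono ((H k).1 t ht).2.2.1 ((H (k + 1)).1 t ht).2.2.1 fun x =>
      mul_le_mul_of_nonneg_left (cutoff_le_cutoff_succ hσ) (by positivity)
  obtain ⟨k₀, hk₀⟩ := Filter.eventually_atTop.1
    (((tendsto_integral_mul_cutoff (σ := σ) (m := m) hu₁).eventually_const_lt
      (half_lt_self hu)).and
      ((tendsto_integral_mul_cutoff (σ := σ) (m := m) hv₁).eventually_const_lt hv))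
  set β : ℝ := 2 * σ - (n + 2 * σ) * (p - 1) / p with hβ
  have hexp1 : β + β * (1 / (p - 1)) + (n + 2 * σ - 2 * σ * (p / (p - 1))) = 0 := by
    rw [hβ]
    field_simp
    ring
  have hexp2 : -(β * (1 / (q - 1))) + (n + 2 * σ - 2 * σ * (q / (q - 1))) ≤ 0 := by
    have hpq : 0 < p * q - 1 := by nlinarith
    rw [div_le_div_iff₀ (by positivity) hpq] at hcrit
    have : -(β * (1 / (q - 1))) + (n + 2 * σ - 2 * σ * (q / (q - 1))) =
        (n * (p * q - 1) - (1 + p) * (2 * σ)) / (p * (q - 1)) := by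
      rw [hβ]
      field_simp
      ring
    rw [this]
    exact div_nonpos_of_nonpos_of_nonneg (by linarith) (by positivity)
  refine false_of_absorption (k₀ := k₀) (K := K) (L := L) hImono hI0 (half_pos hu)
    (one_div_pos.2 hp1) (one_div_pos.2 hq1) fun δ ε hδ hε k hk => ?_
  set R : ℝ := 2 ^ (k + 1)
  have hR : 0 < R := by positivity
  have hR1 : 1 ≤ R := one_le_pow₀ one_le_two
  obtain ⟨hu0, hv0⟩ := hk₀ (k + 1) (by omega)
  have E₁ := hKu k (δ * R ^ β) (by positivity)
  have E₂ := hLv k (ε * R ^ (-β)) (by positivity)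
  rw [(H (k + 1)).2.2.2.2.2.1] at E₁
  rw [(H (k + 1)).2.2.2.2.2.2] at E₂
  change _ + I (k + 1) ≤ _ * (J (k + 1) - J k) + _ at E₁
  change _ + J (k + 1) ≤ _ * (I (k + 1) - I k) + _ at E₂
  have hJle : J (k + 1) - J k ≤ ε * R ^ (-β) * (I (k + 1) - I k) +
      (ε * R ^ (-β)) ^ (-(1 / (p - 1))) *
        (L * R ^ ((n : ℝ) + 2 * σ - 2 * σ * (p / (p - 1)))) := by
    have := hJ0 k
    linarith
  have hmain := mul_le_mul_of_nonneg_left hJle (show 0 ≤ δ * R ^ β by positivity)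
  have t1 : δ * R ^ β * (ε * R ^ (-β) * (I (k + 1) - I k) + (ε * R ^ (-β)) ^ (-(1 / (p - 1))) *
        (L * R ^ ((n : ℝ) + 2 * σ - 2 * σ * (p / (p - 1))))) =
      δ * ε * (I (k + 1) - I k) + δ * ε ^ (-(1 / (p - 1))) * L := by
    have r1 : R ^ β * R ^ (-β) = 1 := by rw [← Real.rpow_add hR]; simp
    have r2 : R ^ β * (R ^ (-β)) ^ (-(1 / (p - 1))) *
        R ^ ((n : ℝ) + 2 * σ - 2 * σ * (p / (p - 1))) = 1 := by
      rw [← Real.rpow_mul hR.le, neg_mul_neg, ← Real.rpow_add hR, ← Real.rpow_add hR, hexp1,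
        Real.rpow_zero]
    rw [Real.mul_rpow hε.le (by positivity)]
    linear_combination (δ * ε * (I (k + 1) - I k)) * r1 + (δ * ε ^ (-(1 / (p - 1))) * L) * r2
  have t2 : (δ * R ^ β) ^ (-(1 / (q - 1))) *
      (K * R ^ ((n : ℝ) + 2 * σ - 2 * σ * (q / (q - 1)))) ≤ δ ^ (-(1 / (q - 1))) * K := by
    have r3 : (R ^ β) ^ (-(1 / (q - 1))) * R ^ ((n : ℝ) + 2 * σ - 2 * σ * (q / (q - 1))) ≤ 1 := by
      rw [← Real.rpow_mul hR.le, mul_neg, ← Real.rpow_add hR]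
      exact Real.rpow_le_one_of_one_le_of_nonpos hR1 hexp2
    rw [Real.mul_rpow hδ.le (by positivity)]
    calc _ = δ ^ (-(1 / (q - 1))) * K * ((R ^ β) ^ (-(1 / (q - 1))) *
          R ^ ((n : ℝ) + 2 * σ - 2 * σ * (q / (q - 1)))) := by ring
      _ ≤ _ := mul_le_of_le_one_right (by positivity) r3
  linarith

/-- **Blow-up at and below the critical exponent, integer case**: if
`n/(2σ) ≤ (1+max{p,q})/(pq−1)` and the initial velocities have positive integral, the
weakly coupled system admits no global weak solution. -/
theorem blowup_integer_case (n : ℕ) (hn : 1 ≤ n) (σ : ℕ) (hσ : 1 ≤ σ)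
    (p q : ℝ) (hp : 1 < p) (hq : 1 < q)
    (hcrit : (n : ℝ) / (2 * σ) ≤ (1 + max p q) / (p * q - 1))
    (u₁ v₁ : Ω n → ℝ) (hu₁ : Integrable u₁ volume) (hv₁ : Integrable v₁ volume)
    (hu : 0 < ∫ x, u₁ x) (hv : 0 < ∫ x, v₁ x) :
    ¬ ∃ u v : ℝ → L2r n, IsWeakSolutionInt n σ p q u₁ v₁ u v := by
  rintro ⟨u, v, h⟩
  rcases le_total q p with hpq | hpq
  · rw [max_eq_left hpq] at hcrit
    exact h.false_of_le hσ hp hq hcrit hu₁ hv₁ hu hv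
  · rw [max_eq_right hpq, mul_comm p q] at hcrit
    exact h.symm.false_of_le hσ hq hp hcrit hv₁ hu₁ hv hu

end
end

section
/- Pointwise bounds for the fractional Laplacian of the Japanese bracket: Let n ≥ 1, let γ > 1 be a non-integer real number with integer part [γ] and fractional part s := γ − [γ] ∈ (0,1), and let r > 0. Then there exists a constant C = C(n,γ,r) > 0 such that for all x ∈ ℝⁿ: |(−Δ)^γ ⟨x⟩^{−r}| ≤ C⟨x⟩^{−r−2γ} if 0 < r + 2[γ] < n; |(−Δ)^γ ⟨x⟩^{−r}| ≤ C⟨x⟩^{−n−2s}·log(e+|x|) if r + 2[γ] = n; and |(−Δ)^γ ⟨x⟩^{−r}| ≤ C⟨x⟩^{−n−2s} if r + 2[γ] > n. (The quantity (−Δ)^γ⟨x⟩^{−r} is well-defined since (−Δ)^{[γ]}⟨x⟩^{−r} is a smooth bounded function with bounded second derivatives, so the singular integral defining its (−Δ)^s converges absolutely.) -/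
open MeasureTheory Real Set
theorem one_le_jb {n : ℕ} (x : Ω n) : 1 ≤ jb x :=
  Real.one_le_sqrt.2 (by nlinarith [sq_nonneg ‖x‖])

theorem jb_pos {n : ℕ} (x : Ω n) : 0 < jb x := one_pos.trans_le (one_le_jb x)

theorem jb_sq {n : ℕ} (x : Ω n) : jb x ^ 2 = 1 + ‖x‖ ^ 2 :=
  Real.sq_sqrt (by positivity)

theorem jb_rpow {n : ℕ} (x : Ω n) (b : ℝ) : jb x ^ b = (1 + ‖x‖ ^ 2) ^ (b / 2) := by
  rw [jb, Real.sqrt_eq_rpow, ← Real.rpow_mul (by positivity)]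
  congr 1; ring

theorem jb_rpow_eq_sq_rpow {n : ℕ} (x : Ω n) (b : ℝ) : jb x ^ b = (jb x ^ 2) ^ (b / 2) := by
  rw [jb_rpow, jb_sq]

theorem contDiff_jb_rpow {n : ℕ} (b : ℝ) : ContDiff ℝ 2 (fun x : Ω n => jb x ^ b) := by
  simp only [jb_rpow]
  exact (contDiff_const.add (contDiff_norm_sq ℝ)).rpow_const_of_ne fun x => by positivity

theorem hasFDerivAt_jb_rpow {n : ℕ} (b : ℝ) (x : Ω n) :
    HasFDerivAt (fun x : Ω n => jb x ^ b) ((b * jb x ^ (b - 2)) • innerSL ℝ x) x := by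
  simp only [jb_rpow]
  have h := (((hasStrictFDerivAt_norm_sq x).hasFDerivAt.const_add 1).rpow_const
    (p := b / 2) (Or.inl (by positivity)))
  refine h.congr_fderiv (ContinuousLinearMap.ext fun v => ?_)
  rw [show (b - 2) / 2 = b / 2 - 1 by ring]
  simp
  ring

theorem fderiv_jb_rpow_single {n : ℕ} (b : ℝ) (i : Fin n) (x : Ω n) :
    fderiv ℝ (fun x : Ω n => jb x ^ b) x (EuclideanSpace.single i 1) =
      b * (jb x ^ (b - 2) * x i) := by
  rw [(hasFDerivAt_jb_rpow b x).fderiv]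
  simp [EuclideanSpace.inner_single_right]
  ring

/-- The Laplacian of a power of the Japanese bracket. -/
theorem negLap_jb_rpow {n : ℕ} (b : ℝ) :
    negLap (fun x : Ω n => jb x ^ b) =
      (-(b * (n + b - 2))) • (fun x : Ω n => jb x ^ (b - 2)) +
        (b * (b - 2)) • (fun x : Ω n => jb x ^ (b - 4)) := by
  funext x
  have hd (i : Fin n) : fderiv ℝ (fun y : Ω n =>
      fderiv ℝ (fun x : Ω n => jb x ^ b) y (EuclideanSpace.single i 1)) x
        (EuclideanSpace.single i 1) =
      b * jb x ^ (b - 2) + b * (b - 2) * jb x ^ (b - 4) * x i ^ 2 := by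
    simp only [fderiv_jb_rpow_single]
    have h := ((hasFDerivAt_jb_rpow (b - 2) x).mul
      (EuclideanSpace.proj (𝕜 := ℝ) i).hasFDerivAt).const_mul b
    have h2 : (fun y : Ω n => b * (jb y ^ (b - 2) * y i)) = fun y =>
      b * (((fun x : Ω n => jb x ^ (b - 2)) * ⇑(EuclideanSpace.proj (𝕜 := ℝ) i)) y) := by
      funext y; simp
    rw [h2, h.fderiv]
    simp [EuclideanSpace.inner_single_right, show b - 2 - 2 = b - 4 by ring]
    ring
  have hs : jb x ^ (b - 2) = jb x ^ (b - 4) * (1 + ‖x‖ ^ 2) := by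
    rw [← jb_sq, ← Real.rpow_natCast, ← Real.rpow_add (jb_pos x)]
    congr 1; push_cast; ring
  have hn : ∑ i, x i ^ 2 = ‖x‖ ^ 2 := (EuclideanSpace.real_norm_sq_eq x).symm
  simp only [negLap, hd, Finset.sum_add_distrib, ← Finset.mul_sum, hn]
  simp
  rw [hs]
  ring

theorem negLap_add {n : ℕ} {f g : Ω n → ℝ} (hf : ContDiff ℝ 2 f) (hg : ContDiff ℝ 2 g) :
    negLap (f + g) = negLap f + negLap g := by
  have hd {f : Ω n → ℝ} (hf : ContDiff ℝ 2 f) (i : Fin n) :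
      Differentiable ℝ (fun y => fderiv ℝ f y (EuclideanSpace.single i 1)) :=
    ((hf.fderiv_right (m := 1) (by norm_num)).differentiable (by norm_num)).clm_apply
      (differentiable_const _)
  funext x
  have h1 (i : Fin n) : (fun y => fderiv ℝ (f + g) y (EuclideanSpace.single i 1)) =
      (fun y => fderiv ℝ f y (EuclideanSpace.single i 1)) +
        fun y => fderiv ℝ g y (EuclideanSpace.single i 1) := by
    funext y
    rw [fderiv_add (hf.differentiable (by norm_num) y) (hg.differentiable (by norm_num) y)]
    rfl
  have h2 (i : Fin n) := fderiv_add (hd hf i x) (hd hg i x)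
  simp only [negLap, h1, h2, Pi.add_apply, _root_.add_apply,
    Finset.sum_add_distrib]
  ring

theorem negLap_smul {n : ℕ} (c : ℝ) (f : Ω n → ℝ) : negLap (c • f) = c • negLap f := by
  funext x
  have h1 (i : Fin n) : (fun y => fderiv ℝ (c • f) y (EuclideanSpace.single i 1)) =
      c • (fun y => fderiv ℝ f y (EuclideanSpace.single i 1)) := by
    funext y
    simp [fderiv_const_smul_field]
  simp only [negLap, h1]
  simp only [fderiv_const_smul_field, Pi.smul_apply, _root_.smul_apply, smul_eq_mul,
    ← Finset.mul_sum, ← mul_neg]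
  rfl

/-- Linear combinations of the functions `⟨x⟩^{-b}` with `b ≥ q`. -/
def jbSpan (n : ℕ) (q : ℝ) : Submodule ℝ (Ω n → ℝ) :=
  Submodule.span ℝ {f | ∃ b, q ≤ b ∧ f = fun x => jb x ^ (-b)}

theorem jb_rpow_mem_jbSpan {n : ℕ} {q b : ℝ} (h : q ≤ -b) :
    (fun x : Ω n => jb x ^ b) ∈ jbSpan n q :=
  Submodule.subset_span ⟨-b, h, by simp⟩

theorem contDiff_and_negLap_mem_jbSpan {n : ℕ} {q : ℝ} {f : Ω n → ℝ} (hf : f ∈ jbSpan n q) :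
    ContDiff ℝ 2 f ∧ negLap f ∈ jbSpan n (q + 2) := by
  induction hf using Submodule.span_induction with
  | mem f hf =>
    obtain ⟨b, hb, rfl⟩ := hf
    refine ⟨contDiff_jb_rpow _, ?_⟩
    rw [negLap_jb_rpow]
    exact add_mem (Submodule.smul_mem _ _ (jb_rpow_mem_jbSpan (by linarith)))
      (Submodule.smul_mem _ _ (jb_rpow_mem_jbSpan (by linarith)))
  | zero =>
    refine ⟨contDiff_const, ?_⟩
    have h : negLap (0 : Ω n → ℝ) = 0 := by simpa using negLap_smul (n := n) 0 0
    rw [h]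
    exact zero_mem _
  | add f g _ _ hf hg =>
    exact ⟨hf.1.add hg.1, negLap_add hf.1 hg.1 ▸ add_mem hf.2 hg.2⟩
  | smul c f _ hf =>
    exact ⟨hf.1.const_smul c, negLap_smul c f ▸ Submodule.smul_mem _ _ hf.2⟩

theorem negLapIter_mem_jbSpan {n : ℕ} {q : ℝ} {f : Ω n → ℝ} (hf : f ∈ jbSpan n q) (m : ℕ) :
    negLapIter m f ∈ jbSpan n (q + 2 * m) := by
  induction m with
  | zero => simpa [negLapIter] using hf
  | succ m ih =>
    rw [negLapIter, Function.iterate_succ_apply']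
    have h := (contDiff_and_negLap_mem_jbSpan ih).2
    rwa [show q + 2 * (m + 1 : ℕ) = q + 2 * m + 2 by push_cast; ring]

/-- Second order Taylor bound at `1` for a negative power, away from the origin. -/
theorem abs_one_add_rpow_sub_le {b : ℝ} (hb : 0 ≤ b) :
    ∃ L, 0 ≤ L ∧ ∀ k : ℝ, -(3 / 4) ≤ k → |(1 + k) ^ (-b) - 1 + b * k| ≤ L * k ^ 2 := by
  have hseg {k z : ℝ} (hk : -(3 / 4) ≤ k) (hz : z ∈ uIcc 0 k) : 1 / 4 ≤ 1 + z := by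
    have := hz.1
    have : min 0 k ≥ -(3 / 4) := le_min (by norm_num) hk
    linarith
  have habs {k z : ℝ} (hz : z ∈ uIcc 0 k) : |z| ≤ |k| := by
    simpa using Set.abs_sub_left_of_mem_uIcc hz
  have hder (c z : ℝ) (hz : 1 / 4 ≤ 1 + z) :
      HasDerivAt (fun z : ℝ => (1 + z) ^ (-c)) (-c * (1 + z) ^ (-c - 1)) z := by
    have := ((hasDerivAt_id z).const_add 1).rpow_const (p := -c) (Or.inl (by simp; linarith))
    simpa using this
  set M : ℝ := (b + 1) * (1 / 4) ^ (-(b + 1) - 1) with hM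
  have hM0 : 0 ≤ M := by positivity
  have h1 {k : ℝ} (hk : -(3 / 4) ≤ k) : |(1 + k) ^ (-(b + 1)) - 1| ≤ M * |k| := by
    have := (convex_uIcc 0 k).norm_image_sub_le_of_norm_hasDerivWithin_le
      (f := fun z : ℝ => (1 + z) ^ (-(b + 1))) (C := M)
      (fun z hz => (hder (b + 1) z (hseg hk hz)).hasDerivWithinAt) (fun z hz => ?_)
      left_mem_uIcc right_mem_uIcc
    · simpa using this
    · have h0 := hseg hk hz
      rw [norm_mul, norm_neg, Real.norm_of_nonneg (by linarith),
        Real.norm_of_nonneg (Real.rpow_nonneg (by linarith) _)]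
      exact mul_le_mul_of_nonneg_left
        (Real.rpow_le_rpow_of_nonpos (by norm_num) h0 (by linarith)) (by linarith)
  refine ⟨b * M, by positivity, fun k hk => ?_⟩
  have := (convex_uIcc 0 k).norm_image_sub_le_of_norm_hasDerivWithin_le
    (f := fun z : ℝ => (1 + z) ^ (-b) + b * z) (C := b * M * |k|)
    (fun z hz => ((hder b z (hseg hk hz)).add
      ((hasDerivAt_id z).const_mul b)).hasDerivWithinAt) (fun z hz => ?_)
    left_mem_uIcc right_mem_uIcc
  · simp only [Real.norm_eq_abs, sub_zero, add_zero, Real.one_rpow, mul_zero] at this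
    rw [mul_assoc, abs_mul_abs_self, ← sq] at this
    convert this using 2
    ring
  · have hz1 : -(3 / 4) ≤ z := by linarith [hseg hk hz]
    have : -b * (1 + z) ^ (-b - 1) + b * 1 = -b * ((1 + z) ^ (-(b + 1)) - 1) := by
      rw [show -(b + 1) = -b - 1 by ring]; ring
    rw [this, norm_mul, norm_neg, Real.norm_of_nonneg hb, mul_assoc]
    exact mul_le_mul_of_nonneg_left ((h1 hz1).trans (mul_le_mul_of_nonneg_left (habs hz) hM0)) hb

theorem norm_le_jb {n : ℕ} (x : Ω n) : ‖x‖ ≤ jb x := by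
  rw [jb]; exact Real.le_sqrt_of_sq_le (by linarith)

theorem jb_le_one_add_norm {n : ℕ} (x : Ω n) : jb x ≤ 1 + ‖x‖ := by
  rw [jb]; exact Real.sqrt_le_iff.2 ⟨by positivity, by nlinarith [norm_nonneg x]⟩

theorem abs_second_difference_jb_rpow_le {n : ℕ} {b : ℝ} (hb : 0 ≤ b) :
    ∃ A, 0 ≤ A ∧ ∀ x y : Ω n, ‖y‖ ≤ jb x / 2 →
      |2 * jb x ^ (-b) - jb (x + y) ^ (-b) - jb (x - y) ^ (-b)| ≤
        A * jb x ^ (-b - 2) * ‖y‖ ^ 2 := by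
  obtain ⟨L, hL, h⟩ := abs_one_add_rpow_sub_le (b := b / 2) (by positivity)
  refine ⟨b + 10 * L, by positivity, fun x y hy => ?_⟩
  have hu : 0 < jb x := jb_pos x
  have hin : |inner ℝ x y| ≤ jb x * ‖y‖ :=
    (abs_real_inner_le_norm x y).trans (by gcongr; exact norm_le_jb x)
  set u := jb x with hudef
  set e := 2 * inner ℝ x y with he
  set d := ‖y‖ ^ 2 with hd
  have hd0 : 0 ≤ d := by positivity
  have he1 : |e| ≤ 2 * u * ‖y‖ := by rw [he, abs_mul, abs_two]; linarith
  have he2 : e ^ 2 ≤ 4 * u ^ 2 * d := by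
    have := sq_le_sq' (by linarith [abs_nonneg e, norm_nonneg y, mul_nonneg hu.le (norm_nonneg y)]) he1
    rw [sq_abs] at this
    calc e ^ 2 ≤ _ := this
      _ = _ := by ring
  have hdu : d ≤ u ^ 2 / 4 := by
    have := pow_le_pow_left₀ (norm_nonneg y) hy 2
    linarith [this, show (u / 2) ^ 2 = u ^ 2 / 4 by ring]
  have hp : jb (x + y) ^ 2 = u ^ 2 + (d + e) := by
    rw [jb_sq, hudef, jb_sq, norm_add_sq_real]; ring
  have hm : jb (x - y) ^ 2 = u ^ 2 + (d - e) := by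
    rw [jb_sq, hudef, jb_sq, norm_sub_sq_real]; ring
  have key (t : ℝ) (ht : -(3 / 4) * u ^ 2 ≤ t) :
      |(u ^ 2 + t) ^ (-b / 2) - u ^ (-b) + b / 2 * t * u ^ (-b - 2)| ≤
        L * t ^ 2 * u ^ (-b - 2) / u ^ 2 := by
    have hk := h (t / u ^ 2) (by rw [le_div_iff₀ (by positivity)]; exact ht)
    have h1 : u ^ 2 + t = u ^ 2 * (1 + t / u ^ 2) := by field_simp
    have h3 : 0 ≤ 1 + t / u ^ 2 := by
      have : -(3 / 4) ≤ t / u ^ 2 := by rw [le_div_iff₀ (by positivity)]; exact ht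
      linarith
    have h2 : u ^ (-b) = u ^ (-b - 2) * u ^ 2 := by
      rw [← Real.rpow_natCast, ← Real.rpow_add hu]; congr 1; push_cast; ring
    have h4 : (u ^ 2) ^ (-b / 2) = u ^ (-b) := by
      rw [hudef, jb_rpow_eq_sq_rpow]
    rw [h1, Real.mul_rpow (by positivity) h3, h4, neg_div]
    have h5 : u ^ (-b) * (1 + t / u ^ 2) ^ (-(b / 2)) - u ^ (-b) + b / 2 * t * u ^ (-b - 2) =
        u ^ (-b) * ((1 + t / u ^ 2) ^ (-(b / 2)) - 1 + b / 2 * (t / u ^ 2)) := by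
      rw [h2]; field_simp
    rw [h5, abs_mul, abs_of_pos (by positivity)]
    calc _ ≤ u ^ (-b) * (L * (t / u ^ 2) ^ 2) := by gcongr
      _ = _ := by rw [h2]; field_simp
  have hlow {t : ℝ} (ht : |t| ≤ 2 * u * ‖y‖) : -(3 / 4) * u ^ 2 ≤ d + t := by
    have := neg_abs_le t
    nlinarith [norm_nonneg y]
  have k1 := key (d + e) (hlow he1)
  have k2 := key (d - e) (hlow (t := -e) (by rwa [abs_neg]))
  rw [jb_rpow_eq_sq_rpow (x + y), jb_rpow_eq_sq_rpow (x - y), hp, hm]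
  set P := (u ^ 2 + (d + e)) ^ (-b / 2)
  set Q := (u ^ 2 + (d - e)) ^ (-b / 2)
  set w := u ^ (-b - 2) with hw
  have hw0 : 0 < w := by positivity
  have hsum : L * (d + e) ^ 2 * w / u ^ 2 + L * (d - e) ^ 2 * w / u ^ 2 ≤ 10 * L * w * d := by
    rw [← add_div, div_le_iff₀ (by positivity)]
    have : (d + e) ^ 2 + (d - e) ^ 2 ≤ 10 * u ^ 2 * d := by nlinarith
    calc _ = L * w * ((d + e) ^ 2 + (d - e) ^ 2) := by ring
      _ ≤ L * w * (10 * u ^ 2 * d) := by gcongr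
      _ = _ := by ring
  have e1 : 2 * u ^ (-b) - P - Q = -(P - u ^ (-b) + b / 2 * (d + e) * w) -
      (Q - u ^ (-b) + b / 2 * (d - e) * w) + b * d * w := by ring
  rw [e1]
  have hbd : 0 ≤ b * d * w := by positivity
  rw [abs_le] at k1 k2 ⊢
  constructor <;> nlinarith

/-- Decay of order `q`, together with a matching bound on symmetric second differences. -/
def SymbolDecay {n : ℕ} (q : ℝ) (f : Ω n → ℝ) : Prop :=
  ∃ A, 0 ≤ A ∧ (∀ x, |f x| ≤ A * jb x ^ (-q)) ∧ ∀ x y, ‖y‖ ≤ jb x / 2 →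
    |2 * f x - f (x + y) - f (x - y)| ≤ A * jb x ^ (-q - 2) * ‖y‖ ^ 2

theorem symbolDecay_of_mem_jbSpan {n : ℕ} {q : ℝ} (hq : 0 ≤ q) {f : Ω n → ℝ}
    (hf : f ∈ jbSpan n q) : SymbolDecay q f := by
  induction hf using Submodule.span_induction with
  | mem f hf =>
    obtain ⟨b, hb, rfl⟩ := hf
    obtain ⟨A, hA, h⟩ := abs_second_difference_jb_rpow_le (n := n) (hq.trans hb)
    refine ⟨A + 1, by positivity, fun x => ?_, fun x y hy => (h x y hy).trans ?_⟩
    · have : 0 < jb x := jb_pos x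
      rw [abs_of_pos (by positivity)]
      have h1 := Real.rpow_le_rpow_of_exponent_le (one_le_jb x) (neg_le_neg hb)
      nlinarith [Real.rpow_pos_of_pos this (-q)]
    · gcongr
      · exact Real.rpow_nonneg (jb_pos x).le _
      · linarith
      · exact one_le_jb x
  | zero => exact ⟨0, le_rfl, by simp, by simp⟩
  | add f g _ _ hf hg =>
    obtain ⟨A, hA, hf1, hf2⟩ := hf
    obtain ⟨B, hB, hg1, hg2⟩ := hg
    refine ⟨A + B, by positivity, fun x => ?_, fun x y hy => ?_⟩
    · rw [add_mul]
      exact (abs_add_le _ _).trans (add_le_add (hf1 x) (hg1 x))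
    · rw [add_mul, add_mul]
      refine le_trans (le_of_eq ?_) ((abs_add_le _ _).trans (add_le_add (hf2 x y hy) (hg2 x y hy)))
      congr 1
      simp only [Pi.add_apply]
      ring
  | smul c f _ hf =>
    obtain ⟨A, hA, hf1, hf2⟩ := hf
    refine ⟨|c| * A, by positivity, fun x => ?_, fun x y hy => ?_⟩
    · rw [Pi.smul_apply, smul_eq_mul, abs_mul, mul_assoc]
      gcongr
      exact hf1 x
    · rw [mul_assoc, mul_assoc, ← mul_assoc A]
      refine le_trans (le_of_eq ?_) (mul_le_mul_of_nonneg_left (hf2 x y hy) (abs_nonneg c))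
      rw [← abs_mul]
      congr 1
      simp only [Pi.smul_apply, smul_eq_mul]
      ring

theorem integral_indicator_norm_rpow {n : ℕ} (hn : 1 ≤ n) {S : Set ℝ} (hS : MeasurableSet S)
    {p : ℝ} (h : IntegrableOn (fun t : ℝ => t ^ ((n : ℝ) - 1 + p)) (Ioi 0 ∩ S)) :
    Integrable (fun y : Ω n => S.indicator (fun t => t ^ p) ‖y‖) ∧
      ∫ y : Ω n, S.indicator (fun t => t ^ p) ‖y‖ =
        n * (volume.real (Metric.ball (0 : Ω n) 1) *
          ∫ t in Ioi 0 ∩ S, t ^ ((n : ℝ) - 1 + p)) := by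
  have : NeZero n := ⟨by omega⟩
  have heq : EqOn (fun t : ℝ => t ^ (n - 1) • S.indicator (fun t => t ^ p) t)
      (S.indicator fun t : ℝ => t ^ ((n : ℝ) - 1 + p)) (Ioi 0) := by
    intro t ht
    by_cases hts : t ∈ S
    · simp only [hts, indicator_of_mem, smul_eq_mul]
      rw [Real.rpow_add ht, ← Real.rpow_natCast, Nat.cast_sub hn, Nat.cast_one]
    · simp [hts]
  constructor
  · rw [integrable_fun_norm_addHaar volume (f := S.indicator fun t : ℝ => t ^ p),
      finrank_euclideanSpace_fin, integrableOn_congr_fun heq measurableSet_Ioi, IntegrableOn,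
      integrable_indicator_iff hS, IntegrableOn, Measure.restrict_restrict hS, inter_comm]
    exact h
  · rw [integral_fun_norm_addHaar volume (S.indicator fun t : ℝ => t ^ p),
      finrank_euclideanSpace_fin, setIntegral_congr_fun measurableSet_Ioi heq,
      setIntegral_indicator hS]
    simp

theorem integral_norm_rpow_Iic {n : ℕ} (hn : 1 ≤ n) {p : ℝ} (hp : 0 < n + p) :
    ∃ K, 0 ≤ K ∧ ∀ R, 0 < R →
      Integrable (fun y : Ω n => (Iic R).indicator (fun t => t ^ p) ‖y‖) ∧
      ∫ y : Ω n, (Iic R).indicator (fun t => t ^ p) ‖y‖ = K * R ^ (n + p) := by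
  refine ⟨n * (volume.real (Metric.ball (0 : Ω n) 1) / (n + p)), by positivity, fun R hR => ?_⟩
  have hp1 : -1 < (n : ℝ) - 1 + p := by linarith
  obtain ⟨h1, h2⟩ := integral_indicator_norm_rpow hn (measurableSet_Iic (a := R)) (p := p)
    (by
      rw [Ioi_inter_Iic, ← intervalIntegrable_iff_integrableOn_Ioc_of_le hR.le]
      exact intervalIntegral.intervalIntegrable_rpow' hp1)
  refine ⟨h1, h2.trans ?_⟩
  rw [Ioi_inter_Iic, ← intervalIntegral.integral_of_le hR.le, integral_rpow (Or.inl hp1),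
    show (n : ℝ) - 1 + p + 1 = n + p by ring, Real.zero_rpow hp.ne']
  ring

theorem integral_norm_rpow_Ioi {n : ℕ} (hn : 1 ≤ n) {p : ℝ} (hp : n + p < 0) :
    ∃ K, 0 ≤ K ∧ ∀ R, 0 < R →
      Integrable (fun y : Ω n => (Ioi R).indicator (fun t => t ^ p) ‖y‖) ∧
      ∫ y : Ω n, (Ioi R).indicator (fun t => t ^ p) ‖y‖ = K * R ^ (n + p) := by
  refine ⟨n * (volume.real (Metric.ball (0 : Ω n) 1) / -(n + p)), ?_, fun R hR => ?_⟩
  · have : 0 < -(n + p) := by linarith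
    positivity
  have hp1 : (n : ℝ) - 1 + p < -1 := by linarith
  have hI : Ioi (0 : ℝ) ∩ Ioi R = Ioi R := inter_eq_right.2 (Ioi_subset_Ioi hR.le)
  obtain ⟨h1, h2⟩ := integral_indicator_norm_rpow hn (measurableSet_Ioi (a := R)) (p := p)
    (by rw [hI]; exact integrableOn_Ioi_rpow_of_lt hp1 hR)
  refine ⟨h1, h2.trans ?_⟩
  rw [hI, integral_Ioi_rpow_of_lt hp1 hR, show (n : ℝ) - 1 + p + 1 = n + p by ring]
  field_simp

theorem integrableOn_jb_rpow_closedBall {n : ℕ} (b R : ℝ) :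
    IntegrableOn (fun z : Ω n => jb z ^ b) (Metric.closedBall 0 R) :=
  (contDiff_jb_rpow b).continuous.continuousOn.integrableOn_compact (isCompact_closedBall 0 R)

theorem setIntegral_jb_rpow_le_integral {n : ℕ} (hn : 1 ≤ n) {q : ℝ} (hq : 0 ≤ q) :
    ∃ K, 0 ≤ K ∧ ∀ R, 0 < R → ∫ z in Metric.closedBall (0 : Ω n) R, jb z ^ (-q) ≤
      K * ∫ t in (1 : ℝ)..(1 + R), t ^ ((n : ℝ) - 1 - q) := by
  have : NeZero n := ⟨by omega⟩
  refine ⟨n * (volume.real (Metric.ball (0 : Ω n) 1) * 2 ^ (q / 2)), by positivity,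
    fun R hR => ?_⟩
  set g : ℝ → ℝ := (Iic R).indicator fun t => (1 + t ^ 2) ^ (-q / 2)
  have hg : ∫ z in Metric.closedBall (0 : Ω n) R, jb z ^ (-q) = ∫ z : Ω n, g ‖z‖ := by
    rw [← integral_indicator Metric.isClosed_closedBall.measurableSet]
    congr 1
    funext z
    by_cases hz : ‖z‖ ≤ R
    · simp [g, hz, jb_rpow]
    · simp [g, hz]
  have hc : ContinuousOn (fun t : ℝ => (1 + t) ^ ((n : ℝ) - 1 - q)) (uIcc 0 R) := by
    refine (by fun_prop : ContinuousOn (fun t : ℝ => 1 + t) _).rpow_const fun t ht => Or.inl ?_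
    rw [uIcc_of_le hR.le] at ht
    linarith [ht.1]
  have hc2 : Continuous (fun t : ℝ => t ^ (n - 1) * (1 + t ^ 2) ^ (-q / 2)) :=
    (continuous_pow _).mul ((by fun_prop : Continuous fun t : ℝ => 1 + t ^ 2).rpow_const
      fun t => Or.inl (by positivity))
  have hle : ∫ t in (0 : ℝ)..R, t ^ (n - 1) * (1 + t ^ 2) ^ (-q / 2) ≤
      ∫ t in (0 : ℝ)..R, 2 ^ (q / 2) * (1 + t) ^ ((n : ℝ) - 1 - q) := by
    refine intervalIntegral.integral_mono_on hR.le (hc2.intervalIntegrable _ _)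
      (hc.intervalIntegrable.const_mul _) fun t ht => ?_
    have ht1 : 0 < 1 + t := by linarith [ht.1]
    have h1 : t ^ (n - 1) ≤ (1 + t) ^ ((n : ℝ) - 1) := by
      rw [show (n : ℝ) - 1 = (n - 1 : ℕ) by rw [Nat.cast_sub hn, Nat.cast_one],
        Real.rpow_natCast]
      exact pow_le_pow_left₀ ht.1 (by linarith) _
    have h2 : (1 + t ^ 2) ^ (-q / 2) ≤ 2 ^ (q / 2) * (1 + t) ^ (-q) := by
      have h3 : (1 + t) ^ 2 / 2 ≤ 1 + t ^ 2 := by nlinarith [sq_nonneg (1 - t)]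
      refine (Real.rpow_le_rpow_of_nonpos (by positivity) h3 (by linarith)).trans_eq ?_
      rw [Real.div_rpow (by positivity) (by norm_num), ← Real.rpow_natCast,
        ← Real.rpow_mul ht1.le, neg_div, Real.rpow_neg (by norm_num : (0 : ℝ) ≤ 2), div_inv_eq_mul,
        mul_comm]
      congr 2
      push_cast; ring
    calc _ ≤ (1 + t) ^ ((n : ℝ) - 1) * (2 ^ (q / 2) * (1 + t) ^ (-q)) :=
          mul_le_mul h1 h2 (by positivity) (by positivity)
      _ = _ := by rw [sub_eq_add_neg _ q, Real.rpow_add ht1]; ring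
  rw [intervalIntegral.integral_const_mul,
    intervalIntegral.integral_comp_add_left (fun t : ℝ => t ^ ((n : ℝ) - 1 - q)) 1, add_zero] at hle
  rw [hg, integral_fun_norm_addHaar volume g, finrank_euclideanSpace_fin]
  have h4 : ∫ t in Ioi (0 : ℝ), t ^ (n - 1) • g t =
      ∫ t in (0 : ℝ)..R, t ^ (n - 1) * (1 + t ^ 2) ^ (-q / 2) := by
    rw [intervalIntegral.integral_of_le hR.le, ← Ioi_inter_Iic,
      ← setIntegral_indicator measurableSet_Iic]
    congr 1
    funext t
    by_cases ht : t ≤ R <;> simp [g, ht]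
  rw [h4, nsmul_eq_mul, smul_eq_mul, mul_assoc (n : ℝ), mul_assoc (volume.real _)]
  gcongr

/-- Growth of the mass of `⟨z⟩^{-q}` on balls, subcritical case. -/
theorem setIntegral_jb_rpow_le_of_lt {n : ℕ} (hn : 1 ≤ n) {q : ℝ} (hq : 0 ≤ q) (hqn : q < n) :
    ∃ K, 0 ≤ K ∧ ∀ x : Ω n, ∫ z in Metric.closedBall (0 : Ω n) (jb x / 2), jb z ^ (-q) ≤
      K * jb x ^ ((n : ℝ) - q) := by
  obtain ⟨K, hK, h⟩ := setIntegral_jb_rpow_le_integral hn hq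
  have hd : 0 < (n : ℝ) - q := by linarith
  refine ⟨K * (2 ^ ((n : ℝ) - q) / (n - q)), by positivity, fun x => ?_⟩
  have hx := one_le_jb x
  refine (h _ (by positivity)).trans ?_
  rw [mul_assoc]
  gcongr
  rw [integral_rpow (Or.inl (by linarith)), show (n : ℝ) - 1 - q + 1 = n - q by ring,
    div_mul_eq_mul_div, ← Real.mul_rpow (by norm_num) (by positivity)]
  gcongr
  have : (1 + jb x / 2) ^ ((n : ℝ) - q) ≤ (2 * jb x) ^ ((n : ℝ) - q) := by
    gcongr; linarith
  have := Real.rpow_nonneg (zero_le_one' ℝ) ((n : ℝ) - q)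
  linarith

/-- Growth of the mass of `⟨z⟩^{-q}` on balls, critical case. -/
theorem setIntegral_jb_rpow_le_of_eq {n : ℕ} (hn : 1 ≤ n) {q : ℝ} (hqn : q = n) :
    ∃ K, 0 ≤ K ∧ ∀ x : Ω n, ∫ z in Metric.closedBall (0 : Ω n) (jb x / 2), jb z ^ (-q) ≤
      K * Real.log (Real.exp 1 + ‖x‖) := by
  subst hqn
  obtain ⟨K, hK, h⟩ := setIntegral_jb_rpow_le_integral hn (Nat.cast_nonneg (α := ℝ) n)
  refine ⟨K, hK, fun x => ?_⟩
  have hx := one_le_jb x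
  refine (h _ (by positivity)).trans ?_
  gcongr
  have h1 : ∀ t : ℝ, t ^ ((n : ℝ) - 1 - n) = t⁻¹ := fun t => by
    rw [show (n : ℝ) - 1 - n = -1 by ring, Real.rpow_neg_one]
  simp only [h1]
  rw [integral_inv_of_pos one_pos (by positivity), div_one]
  have := jb_le_one_add_norm x
  have := Real.add_one_le_exp 1
  exact Real.log_le_log (by positivity) (by linarith [norm_nonneg x])

/-- Growth of the mass of `⟨z⟩^{-q}` on balls, integrable case. -/
theorem setIntegral_jb_rpow_le_of_gt {n : ℕ} {q : ℝ} (hqn : n < q) :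
    ∃ K, 0 ≤ K ∧ ∀ x : Ω n, ∫ z in Metric.closedBall (0 : Ω n) (jb x / 2), jb z ^ (-q) ≤ K := by
  have h0 : ∀ z : Ω n, 0 ≤ jb z ^ (-q) := fun z => Real.rpow_nonneg (jb_pos z).le _
  refine ⟨∫ z : Ω n, jb z ^ (-q), integral_nonneg h0, fun x => ?_⟩
  refine setIntegral_le_integral ?_ (Filter.Eventually.of_forall h0)
  simp only [jb_rpow]
  exact integrable_rpow_neg_one_add_norm_sq (by simpa using hqn)

set_option maxHeartbeats 800000 in
/-- The singular integral of a function with symbol-type decay converges absolutely and is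
controlled by its decay and its mass on a comparable ball. -/
theorem SymbolDecay.abs_integral_fracIntegrand_le {n : ℕ} (hn : 1 ≤ n) {q s : ℝ} (hq : 0 ≤ q)
    (hs0 : 0 < s) (hs1 : s < 1) {f : Ω n → ℝ} (hfc : Continuous f) (hf : SymbolDecay q f) :
    ∃ K, 0 ≤ K ∧ ∀ x, Integrable (fracIntegrand s f x) ∧
      |∫ y, fracIntegrand s f x y| ≤ K * (jb x ^ (-q - 2 * s) + jb x ^ (-(n : ℝ) - 2 * s) *
        ∫ z in Metric.closedBall (0 : Ω n) (jb x / 2), jb z ^ (-q)) := by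
  obtain ⟨A, hA, hf1, hf2⟩ := hf
  obtain ⟨K₁, hK₁, hin⟩ := integral_norm_rpow_Iic hn (p := 2 - (n + 2 * s)) (by linarith)
  obtain ⟨K₂, hK₂, hout⟩ := integral_norm_rpow_Ioi hn (p := -(n + 2 * s)) (by linarith)
  set a : ℝ := A * K₁ * (2⁻¹ : ℝ) ^ (2 - 2 * s) + 4 * A * K₂ * (2⁻¹ : ℝ) ^ (-q - 2 * s) with ha
  set b : ℝ := 2 * A * (2⁻¹ : ℝ) ^ (-(n : ℝ) - 2 * s) with hb
  have ha0 : 0 ≤ a := by positivity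
  have hb0 : 0 ≤ b := by positivity
  refine ⟨a + b, by positivity, fun x => ?_⟩
  have hu := jb_pos x
  set u := jb x with hu_def
  set R := u / 2 with hR_def
  have hR : 0 < R := by positivity
  set H : Ω n → ℝ := (Metric.closedBall (0 : Ω n) R).indicator fun z => jb z ^ (-q) with hH_def
  have hm : MeasurableSet (Metric.closedBall (0 : Ω n) R) :=
    Metric.isClosed_closedBall.measurableSet
  have hHi : Integrable H :=
    (integrable_indicator_iff hm).2 (integrableOn_jb_rpow_closedBall (-q) R)
  have hH0 : ∀ z, 0 ≤ H z := fun z =>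
    indicator_nonneg (fun z _ => Real.rpow_nonneg (jb_pos z).le _) z
  have hfH (z : Ω n) : |f z| ≤ A * R ^ (-q) + A * H z := by
    by_cases hz : ‖z‖ ≤ R
    · have : H z = jb z ^ (-q) := indicator_of_mem (by simpa using hz) _
      rw [this]
      have : 0 ≤ A * R ^ (-q) := by positivity
      linarith [hf1 z]
    · have h1 : jb z ^ (-q) ≤ R ^ (-q) :=
        Real.rpow_le_rpow_of_nonpos hR ((not_le.1 hz).le.trans (norm_le_jb z)) (by linarith)
      have := mul_le_mul_of_nonneg_left h1 hA
      have := mul_nonneg hA (hH0 z)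
      linarith [hf1 z]
  set G₁ : Ω n → ℝ := fun y => (Iic R).indicator (fun t : ℝ => t ^ (2 - (n + 2 * s))) ‖y‖
  set G₂ : Ω n → ℝ := fun y => (Ioi R).indicator (fun t : ℝ => t ^ (-(n + 2 * s))) ‖y‖
  obtain ⟨hi1, he1⟩ := hin R hR
  obtain ⟨hi2, he2⟩ := hout R hR
  have hi3 : Integrable fun y => H (x + y) := hHi.comp_add_left x
  have hi4 : Integrable fun y => H (x - y) := hHi.comp_sub_left x
  have hi12 := (hi1.const_mul (A * u ^ (-q - 2))).add (hi2.const_mul (4 * A * R ^ (-q)))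
  have hi34 := (hi3.add hi4).const_mul (A * R ^ (-(n + 2 * s)))
  have hG := hi12.add hi34
  have hbd (y : Ω n) : ‖fracIntegrand s f x y‖ ≤
      (A * u ^ (-q - 2) * G₁ y + 4 * A * R ^ (-q) * G₂ y) +
        A * R ^ (-(n + 2 * s)) * (H (x + y) + H (x - y)) := by
    have hH2 : 0 ≤ A * R ^ (-(n + 2 * s)) * (H (x + y) + H (x - y)) :=
      mul_nonneg (by positivity) (add_nonneg (hH0 _) (hH0 _))
    rcases eq_or_ne y 0 with rfl | hy0
    · have h0 : fracIntegrand s f x 0 = 0 := by simp [fracIntegrand, two_mul]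
      have h1 : 0 ≤ G₁ 0 := indicator_apply_nonneg fun _ => Real.rpow_nonneg (norm_nonneg _) _
      have h2 : 0 ≤ G₂ 0 := indicator_apply_nonneg fun _ => Real.rpow_nonneg (norm_nonneg _) _
      rw [h0, norm_zero]
      positivity
    have hy : 0 < ‖y‖ := norm_pos_iff.2 hy0
    rw [fracIntegrand, norm_div, Real.norm_eq_abs, Real.norm_of_nonneg (by positivity),
      div_eq_mul_inv, ← Real.rpow_neg hy.le]
    rcases le_or_gt ‖y‖ R with hyR | hyR
    · have h1 : G₁ y = ‖y‖ ^ 2 * ‖y‖ ^ (-(n + 2 * s)) := by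
        rw [← Real.rpow_natCast, ← Real.rpow_add hy]
        simp only [G₁]
        rw [indicator_of_mem (by simpa using hyR)]
        congr 1
      have h2 : G₂ y = 0 := indicator_of_notMem (by simpa using hyR) _
      rw [h1, h2, ← mul_assoc, mul_zero, add_zero]
      have := mul_le_mul_of_nonneg_right (hf2 x y hyR)
        (Real.rpow_nonneg hy.le (-(n + 2 * s)))
      linarith
    · have h1 : G₁ y = 0 := indicator_of_notMem (by simpa using hyR) _
      have h2 : G₂ y = ‖y‖ ^ (-(n + 2 * s)) := indicator_of_mem (by simpa using hyR) _
      have h3 : ‖y‖ ^ (-(n + 2 * s)) ≤ R ^ (-(n + 2 * s)) :=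
        Real.rpow_le_rpow_of_nonpos hR hyR.le
          (by have := Nat.cast_nonneg (α := ℝ) n; linarith)
      have h4 : |f x| ≤ A * R ^ (-q) := by
        refine (hf1 x).trans (mul_le_mul_of_nonneg_left ?_ hA)
        exact Real.rpow_le_rpow_of_nonpos hR (by rw [hR_def]; linarith) (by linarith)
      have h5 : |2 * f x - f (x + y) - f (x - y)| ≤
          4 * A * R ^ (-q) + A * (H (x + y) + H (x - y)) := by
        have := hfH (x + y)
        have := hfH (x - y)
        rw [abs_le] at *
        constructor <;> linarith
      rw [h1, h2, mul_zero, zero_add]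
      have h6 : 0 ≤ A * (H (x + y) + H (x - y)) :=
        mul_nonneg hA (add_nonneg (hH0 _) (hH0 _))
      calc _ ≤ (4 * A * R ^ (-q) + A * (H (x + y) + H (x - y))) * ‖y‖ ^ (-(n + 2 * s)) := by
            gcongr
        _ ≤ 4 * A * R ^ (-q) * ‖y‖ ^ (-(n + 2 * s)) +
            A * (H (x + y) + H (x - y)) * R ^ (-(n + 2 * s)) := by
            rw [add_mul]; gcongr
        _ = _ := by ring
  have hmeas : AEStronglyMeasurable (fracIntegrand s f x) := by
    have hfm := hfc.measurable
    unfold fracIntegrand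
    exact (by fun_prop : Measurable _).aestronglyMeasurable
  refine ⟨hG.mono' hmeas (Filter.Eventually.of_forall hbd), ?_⟩
  refine (norm_integral_le_of_norm_le hG (Filter.Eventually.of_forall hbd)).trans ?_
  rw [integral_add' hi12 hi34, integral_add' (hi1.const_mul _) (hi2.const_mul _),
    integral_const_mul, integral_const_mul, integral_const_mul, he1, he2,
    integral_add' hi3 hi4, integral_add_left_eq_self, integral_sub_left_eq_self, hH_def,
    integral_indicator hm]
  set I := ∫ z in Metric.closedBall (0 : Ω n) R, jb z ^ (-q)
  have hI : 0 ≤ I := setIntegral_nonneg hm fun z _ => Real.rpow_nonneg (jb_pos z).le _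
  have hRp (c : ℝ) : R ^ c = u ^ c * (2⁻¹ : ℝ) ^ c := by
    rw [hR_def, div_eq_mul_inv, Real.mul_rpow hu.le (by norm_num)]
  have e1 : u ^ (-q - 2) * R ^ ((n : ℝ) + (2 - (n + 2 * s))) =
      u ^ (-q - 2 * s) * (2⁻¹ : ℝ) ^ (2 - 2 * s) := by
    rw [hRp, ← mul_assoc, ← Real.rpow_add hu]
    congr 2 <;> ring
  have e2 : R ^ (-q) * R ^ ((n : ℝ) + -(n + 2 * s)) =
      u ^ (-q - 2 * s) * (2⁻¹ : ℝ) ^ (-q - 2 * s) := by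
    rw [← Real.rpow_add hR, ← hRp]
    congr 1; ring
  have e3 : R ^ (-((n : ℝ) + 2 * s)) =
      u ^ (-(n : ℝ) - 2 * s) * (2⁻¹ : ℝ) ^ (-(n : ℝ) - 2 * s) := by
    rw [← hRp]; congr 1; ring
  calc _ = A * K₁ * (u ^ (-q - 2) * R ^ ((n : ℝ) + (2 - (n + 2 * s)))) +
        4 * A * K₂ * (R ^ (-q) * R ^ ((n : ℝ) + -(n + 2 * s))) +
        2 * A * R ^ (-((n : ℝ) + 2 * s)) * I := by ring
    _ = a * u ^ (-q - 2 * s) + b * (u ^ (-(n : ℝ) - 2 * s) * I) := by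
      rw [e1, e2, e3, ha, hb]; ring
    _ ≤ (a + b) * u ^ (-q - 2 * s) + (a + b) * (u ^ (-(n : ℝ) - 2 * s) * I) := by
      have hX : 0 ≤ u ^ (-q - 2 * s) := Real.rpow_nonneg hu.le _
      have hY : 0 ≤ u ^ (-(n : ℝ) - 2 * s) * I := mul_nonneg (Real.rpow_nonneg hu.le _) hI
      exact add_le_add (mul_le_mul_of_nonneg_right (le_add_of_nonneg_right hb0) hX)
        (mul_le_mul_of_nonneg_right (le_add_of_nonneg_left ha0) hY)
    _ = _ := by ring

/-- **Pointwise bounds for the fractional Laplacian of the Japanese bracket**: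
for non-integer `γ > 1` with fractional part `s` and `r > 0`, the singular integral
defining `(−Δ)^γ⟨x⟩^{−r}` converges absolutely and obeys the three pointwise bounds
according to the position of `r + 2[γ]` relative to `n`. -/
theorem fracLap_jb_pointwise_bounds (n : ℕ) (hn : 1 ≤ n) (γ : ℝ) (hγ : 1 < γ)
    (hγni : ∀ m : ℤ, (m : ℝ) ≠ γ) (r : ℝ) (hr : 0 < r) :
    ∃ C : ℝ, 0 < C ∧ ∀ x : Ω n,
      Integrable
        (fracIntegrand (γ - ⌊γ⌋₊) (negLapIter ⌊γ⌋₊ (fun z : Ω n => jb z ^ (-r))) x) volume ∧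
      (r + 2 * ⌊γ⌋₊ < (n : ℝ) →
        |fracLap γ (fun z : Ω n => jb z ^ (-r)) x| ≤ C * jb x ^ (-r - 2 * γ)) ∧
      (r + 2 * ⌊γ⌋₊ = (n : ℝ) →
        |fracLap γ (fun z : Ω n => jb z ^ (-r)) x| ≤
          C * jb x ^ (-(n : ℝ) - 2 * (γ - ⌊γ⌋₊)) * Real.log (Real.exp 1 + ‖x‖)) ∧
      ((n : ℝ) < r + 2 * ⌊γ⌋₊ →
        |fracLap γ (fun z : Ω n => jb z ^ (-r)) x| ≤ C * jb x ^ (-(n : ℝ) - 2 * (γ - ⌊γ⌋₊))) := by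
  set m := ⌊γ⌋₊ with hm
  set s : ℝ := γ - m with hs
  set q : ℝ := r + 2 * m with hqd
  set f := negLapIter m (fun z : Ω n => jb z ^ (-r))
  have hs0 : 0 < s := by
    have h1 : (m : ℝ) ≤ γ := Nat.floor_le (by linarith)
    exact sub_pos.2 (lt_of_le_of_ne h1 (by exact_mod_cast hγni m))
  have hs1 : s < 1 := by
    have := Nat.lt_floor_add_one γ
    rw [← hm] at this
    linarith
  have hq : 0 ≤ q := by positivity
  have hf : f ∈ jbSpan n q := negLapIter_mem_jbSpan (jb_rpow_mem_jbSpan (by simp)) m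
  obtain ⟨K, hK, h⟩ := (symbolDecay_of_mem_jbSpan hq hf).abs_integral_fracIntegrand_le hn hq
    hs0 hs1 (contDiff_and_negLap_mem_jbSpan hf).1.continuous
  have hL (x : Ω n) : |fracLap γ (fun z : Ω n => jb z ^ (-r)) x| ≤
      |fracC n s / 2| * (K * (jb x ^ (-q - 2 * s) + jb x ^ (-(n : ℝ) - 2 * s) *
        ∫ z in Metric.closedBall (0 : Ω n) (jb x / 2), jb z ^ (-q))) := by
    rw [fracLap, fracLapS, abs_mul]
    exact mul_le_mul_of_nonneg_left (h x).2 (abs_nonneg _)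
  set c := |fracC n s / 2| with hc
  have hc0 : 0 ≤ c := abs_nonneg _
  rcases lt_trichotomy q n with hqn | hqn | hqn
  · obtain ⟨M, hM, hI⟩ := setIntegral_jb_rpow_le_of_lt hn hq hqn
    refine ⟨c * (K * (1 + M)) + 1, by positivity, fun x => ⟨(h x).1, fun _ => ?_,
      fun h' => absurd h' hqn.ne, fun h' => absurd h' hqn.not_gt⟩⟩
    have hu := jb_pos x
    have e : jb x ^ (-(n : ℝ) - 2 * s) * jb x ^ ((n : ℝ) - q) = jb x ^ (-q - 2 * s) := by
      rw [← Real.rpow_add hu]; congr 1; ring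
    have e' : -r - 2 * γ = -q - 2 * s := by rw [hqd, hs]; ring
    rw [e']
    calc _ ≤ _ := hL x
      _ ≤ c * (K * (jb x ^ (-q - 2 * s) + jb x ^ (-(n : ℝ) - 2 * s) *
          (M * jb x ^ ((n : ℝ) - q)))) := by gcongr; exact hI x
      _ = c * (K * (1 + M)) * jb x ^ (-q - 2 * s) := by rw [← e]; ring
      _ ≤ _ := by gcongr; linarith
  · obtain ⟨M, hM, hI⟩ := setIntegral_jb_rpow_le_of_eq hn hqn
    refine ⟨c * (K * (1 + M)) + 1, by positivity, fun x => ⟨(h x).1,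
      fun h' => absurd hqn h'.ne, fun _ => ?_, fun h' => absurd hqn h'.ne'⟩⟩
    have hu := jb_pos x
    have hl : 1 ≤ Real.log (Real.exp 1 + ‖x‖) := by
      rw [Real.le_log_iff_exp_le (by positivity)]
      linarith [norm_nonneg x]
    set l := Real.log (Real.exp 1 + ‖x‖)
    calc _ ≤ _ := hL x
      _ ≤ c * (K * (jb x ^ (-(n : ℝ) - 2 * s) * l + jb x ^ (-(n : ℝ) - 2 * s) * (M * l))) := by
        gcongr
        · rw [hqn]
          exact le_mul_of_one_le_right (by positivity) hl
        · exact hI x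
      _ = c * (K * (1 + M)) * jb x ^ (-(n : ℝ) - 2 * s) * l := by ring
      _ ≤ _ := by gcongr; linarith
  · obtain ⟨M, hM, hI⟩ := setIntegral_jb_rpow_le_of_gt hqn
    refine ⟨c * (K * (1 + M)) + 1, by positivity, fun x => ⟨(h x).1,
      fun h' => absurd h' hqn.not_gt, fun h' => absurd h' hqn.ne', fun _ => ?_⟩⟩
    have hu := jb_pos x
    calc _ ≤ _ := hL x
      _ ≤ c * (K * (jb x ^ (-(n : ℝ) - 2 * s) + jb x ^ (-(n : ℝ) - 2 * s) * M)) := by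
        gcongr
        · exact one_le_jb x
        · exact hI x
      _ = c * (K * (1 + M)) * jb x ^ (-(n : ℝ) - 2 * s) := by ring
      _ ≤ _ := by gcongr; linarith
end

section
/- Iteration inequality from the critical functional inequality: Let a > 1, K > 0 and C₀ > 0 be real numbers, and suppose J ≥ 0 satisfies J + C₀ ≤ K·J^{1/a}. Then for every integer j ≥ 1: J ≥ K^{a/(a−1)}·(C₀/K^{a/(a−1)})^{a^j}. -/
/-- **Iteration inequality from the critical functional inequality**:
if `a > 1`, `K > 0`, `C₀ > 0` and `J ≥ 0` satisfies `J + C₀ ≤ K J^{1/a}`, then for every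
integer `j ≥ 1`, `J ≥ K^{a/(a−1)} (C₀ / K^{a/(a−1)})^{a^j}`. -/
theorem iteration_from_critical_inequality (a K C₀ J : ℝ) (ha : 1 < a) (hK : 0 < K)
    (hC₀ : 0 < C₀) (hJ : 0 ≤ J) (h : J + C₀ ≤ K * J ^ (1 / a)) :
    ∀ j : ℕ, 1 ≤ j →
      K ^ (a / (a - 1)) * (C₀ / K ^ (a / (a - 1))) ^ (a ^ (j : ℕ)) ≤ J := by
  intro j hj
  have ha0 : 0 < a := by linarith
  have ha1 : 0 < a - 1 := by linarith
  set M : ℝ := K ^ (a / (a - 1)) with hM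
  have hMpos : 0 < M := Real.rpow_pos_of_pos hK _
  have hKM : K * M ^ (1 / a) = M := by
    rw [hM, ← Real.rpow_mul hK.le, ← Real.rpow_one_add' hK.le (by positivity)]
    congr 1
    field_simp
    ring
  obtain ⟨x, rfl⟩ : ∃ x, J = M * x := ⟨J / M, by field_simp⟩
  obtain ⟨c, rfl⟩ : ∃ c, C₀ = M * c := ⟨C₀ / M, by field_simp⟩
  have hx : 0 ≤ x := nonneg_of_mul_nonneg_right hJ hMpos
  have hc : 0 < c := pos_of_mul_pos_right hC₀ hMpos.le
  have hnormalized : x + c ≤ x ^ (1 / a) := by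
    rw [Real.mul_rpow hMpos.le hx, ← mul_assoc, hKM, ← mul_add] at h
    exact le_of_mul_le_mul_left h hMpos
  have hca : c ^ a ≤ x := by
    calc c ^ a ≤ (x ^ (1 / a)) ^ a := Real.rpow_le_rpow hc.le (by linarith) ha0.le
      _ = x := by rw [← Real.rpow_mul hx, one_div_mul_cancel ha0.ne', Real.rpow_one]
  have hx1 : x ≤ 1 := by
    by_contra! hlt
    have hroot : x ^ (1 / a) ≤ x ^ (1 : ℝ) :=
      Real.rpow_le_rpow_of_exponent_le hlt.le ((div_le_one ha0).2 ha.le)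
    rw [Real.rpow_one] at hroot
    linarith
  have hc1 : c ≤ 1 := by
    have := Real.rpow_le_one hx hx1 (one_div_pos.2 ha0).le
    linarith
  rw [mul_div_cancel_left₀ c hMpos.ne']
  refine mul_le_mul_of_nonneg_left ?_ hMpos.le
  exact (Real.rpow_le_rpow_of_exponent_ge hc hc1
    (le_self_pow₀ ha.le (Nat.one_le_iff_ne_zero.1 hj))).trans hca
end
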